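/- Let n ≥ 1, s ∈ ℝ and 1 ≤ p, q ≤ ∞ with p ≠ q. If there exists a constant C > 0 such that ‖e^{iΔ}f‖_{W_{p,q}} ≤ C‖f‖_{W^s_{p,q}} for all f ∈ 𝒮(ℝⁿ), then s > n|1/p − 1/q| (with the convention 1/∞ = 0). -/

import Mathlib

open MeasureTheory Real
open scoped ENNReal RealInnerProductSpace

noncomputable section

/-- The short-time Fourier transform
`V_g f (x, ξ) = ∫ e^{-i ξ·t} conj (g (t - x)) f t dt`. -/
def STFT {n : ℕ} (g f : EuclideanSpace ℝ (Fin n) → ℂ)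
    (x ξ : EuclideanSpace ℝ (Fin n)) : ℂ :=
  ∫ t : EuclideanSpace ℝ (Fin n),
    Complex.exp (-(Complex.I * Complex.ofReal ⟪ξ, t⟫)) * (starRingEnd ℂ) (g (t - x)) * f t

/-- The Fourier transform `f̂ (ξ) = ∫ e^{-i ξ·x} f x dx`. -/
def FT {n : ℕ} (f : EuclideanSpace ℝ (Fin n) → ℂ) (ξ : EuclideanSpace ℝ (Fin n)) : ℂ :=
  ∫ x : EuclideanSpace ℝ (Fin n),
    Complex.exp (-(Complex.I * Complex.ofReal ⟪ξ, x⟫)) * f x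

/-- The power of the Japanese bracket `⟨x⟩ˢ = (1 + |x|²)^(s/2)`. -/
def jp {n : ℕ} (s : ℝ) (x : EuclideanSpace ℝ (Fin n)) : ℝ := (1 + ‖x‖ ^ 2) ^ (s / 2)

/-- The Gaussian window `g₀ (t) = e^{-|t|²}`. -/
def gauss {n : ℕ} (t : EuclideanSpace ℝ (Fin n)) : ℂ := Complex.ofReal (Real.exp (-‖t‖ ^ 2))

/-- The `L^p` norm (valued in `ℝ≥0∞`) of an `ℝ≥0∞`-valued function. -/
def lpN {n : ℕ} (p : ℝ≥0∞) (F : EuclideanSpace ℝ (Fin n) → ℝ≥0∞) : ℝ≥0∞ :=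
  if p = ∞ then essSup F volume
  else (∫⁻ x, F x ^ p.toReal) ^ p.toReal⁻¹

/-- The Wiener amalgam space norm `‖f‖_{W^s_{p,q}}`:
inner `L^q` norm in the frequency variable ξ, outer `L^p` norm in the space variable x,
with the Gaussian window. -/
def WNorm {n : ℕ} (s : ℝ) (p q : ℝ≥0∞) (f : EuclideanSpace ℝ (Fin n) → ℂ) : ℝ≥0∞ :=
  lpN p (fun x => lpN q (fun ξ => ENNReal.ofReal (jp s ξ) * (‖STFT gauss f x ξ‖₊ : ℝ≥0∞)))

/-- The modulation space norm `‖f‖_{M^s_{p,q}}`: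
inner `L^p` norm in the space variable x, outer `L^q` norm in the frequency variable ξ,
with the Gaussian window. -/
def MNorm {n : ℕ} (s : ℝ) (p q : ℝ≥0∞) (f : EuclideanSpace ℝ (Fin n) → ℂ) : ℝ≥0∞ :=
  lpN q (fun ξ => lpN p (fun x => ENNReal.ofReal (jp s ξ) * (‖STFT gauss f x ξ‖₊ : ℝ≥0∞)))

/-- The Schrödinger operator `e^{iεΔ} f = ℱ⁻¹ [ξ ↦ e^{-iε|ξ|²} f̂ (ξ)]` (`ε = ±1`). -/
def schrod {n : ℕ} (ε : ℝ) (f : EuclideanSpace ℝ (Fin n) → ℂ)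
    (x : EuclideanSpace ℝ (Fin n)) : ℂ :=
  (((2 * Real.pi) ^ n)⁻¹ : ℝ) *
    ∫ ξ : EuclideanSpace ℝ (Fin n),
      Complex.exp (Complex.I * Complex.ofReal ⟪x, ξ⟫) *
        Complex.exp (-(Complex.ofReal ε * Complex.I * Complex.ofReal (‖ξ‖ ^ 2))) * FT f ξ

/-- The lattice point `k ∈ ℤⁿ` viewed as a point of `ℝⁿ`. -/
def zlift {n : ℕ} (k : Fin n → ℤ) : EuclideanSpace ℝ (Fin n) :=
  (WithLp.equiv 2 (Fin n → ℝ)).symm fun i => (k i : ℝ)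

/-- A power of `1 + v` times a decaying exponential is bounded on the half-line. -/
lemma exists_one_add_rpow_mul_exp_neg_le (τ : ℝ) {c : ℝ} (hτ : 0 ≤ τ) (hc : 0 < c) :
    ∃ M : ℝ, 0 < M ∧ ∀ v : ℝ, 0 ≤ v → (1 + v) ^ τ * Real.exp (-(c * v)) ≤ M := by
  set δ := c / (τ + 1) with hδ
  have hδ0 : 0 < δ := by positivity
  refine ⟨(1 + δ⁻¹) ^ τ, by positivity, fun v hv => ?_⟩
  have h1 : 1 + v ≤ (1 + δ⁻¹) * Real.exp (δ * v) := by
    have := Real.add_one_le_exp (δ * v)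
    have h2 : (1 + δ⁻¹) * (δ * v + 1) = 1 + v + (δ * v + δ⁻¹) := by field_simp; ring
    have h3 : 0 ≤ δ * v + δ⁻¹ := by positivity
    calc 1 + v ≤ (1 + δ⁻¹) * (δ * v + 1) := by rw [h2]; linarith
      _ ≤ _ := by gcongr
  calc (1 + v) ^ τ * Real.exp (-(c * v))
      ≤ ((1 + δ⁻¹) * Real.exp (δ * v)) ^ τ * Real.exp (-(c * v)) := by gcongr
    _ = (1 + δ⁻¹) ^ τ * Real.exp (δ * v * τ - c * v) := by
        rw [Real.mul_rpow (by positivity) (by positivity), ← Real.exp_mul, mul_assoc,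
          ← Real.exp_add, sub_eq_add_neg]
    _ ≤ (1 + δ⁻¹) ^ τ * 1 := by
        gcongr
        rw [Real.exp_le_one_iff]
        have : c = δ * (τ + 1) := by rw [hδ]; field_simp
        rw [this]
        nlinarith [mul_nonneg hδ0.le hv]
    _ = _ := mul_one _

lemma iteratedDeriv_cexp_neg_mul_ofReal (z : ℂ) (k : ℕ) :
    iteratedDeriv k (fun r : ℝ => Complex.exp (-z * (r : ℂ)))
      = fun r : ℝ => (-z) ^ k * Complex.exp (-z * (r : ℂ)) := by
  induction k with
  | zero => simp
  | succ k ih =>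
    rw [iteratedDeriv_succ, ih]
    ext r
    have h : HasDerivAt (fun r : ℝ => Complex.exp (-z * (r : ℂ)))
        (Complex.exp (-z * (r : ℂ)) * (-z * 1)) r :=
      ((Complex.ofRealCLM.hasDerivAt (x := r)).const_mul (-z)).cexp
    rw [(h.const_mul _).deriv]
    ring

/-- The Gaussian `t ↦ exp (-z |t|²)` with complex parameter `z`. -/
def cgauss {n : ℕ} (z : ℂ) (t : EuclideanSpace ℝ (Fin n)) : ℂ :=
  Complex.exp (-z * Complex.ofReal (‖t‖ ^ 2))

lemma contDiff_cexp_neg_mul_ofReal (z : ℂ) {m : WithTop ℕ∞} :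
    ContDiff ℝ m (fun r : ℝ => Complex.exp (-z * (r : ℂ))) :=
  (contDiff_const.mul Complex.ofRealCLM.contDiff).cexp

lemma exists_pow_mul_norm_iteratedFDeriv_cgauss_le {n : ℕ} {z : ℂ} (hz : 0 < z.re) (k m : ℕ) :
    ∃ C : ℝ, ∀ x : EuclideanSpace ℝ (Fin n),
      ‖x‖ ^ k * ‖iteratedFDeriv ℝ m (cgauss z) x‖ ≤ C := by
  obtain ⟨l, C₀, hC₀, hb⟩ := (Function.hasTemperateGrowth_norm_sq
    (H := EuclideanSpace ℝ (Fin n))).norm_iteratedFDeriv_le_uniform m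
  obtain ⟨M, hM, hMb⟩ := exists_one_add_rpow_mul_exp_neg_le ((k + l * m : ℕ) : ℝ)
    (by positivity) hz
  refine ⟨2 ^ (k + l * m) * (m.factorial * (1 + ‖z‖) ^ m * (1 + C₀) ^ m * M), fun x => ?_⟩
  have key : ‖iteratedFDeriv ℝ m ((fun r : ℝ => Complex.exp (-z * (r : ℂ))) ∘
      fun x : EuclideanSpace ℝ (Fin n) => ‖x‖ ^ 2) x‖ ≤
      m.factorial * ((1 + ‖z‖) ^ m * Real.exp (-(z.re * ‖x‖ ^ 2))) *
        ((1 + C₀) * (1 + ‖x‖) ^ l) ^ m := by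
    refine norm_iteratedFDeriv_comp_le (N := m) (contDiff_cexp_neg_mul_ofReal z)
      (contDiff_norm_sq ℝ) le_rfl x ?_ ?_
    · intro i hi
      rw [norm_iteratedFDeriv_eq_norm_iteratedDeriv, iteratedDeriv_cexp_neg_mul_ofReal, norm_mul,
        norm_pow, norm_neg, Complex.norm_exp]
      have h1 : ‖z‖ ^ i ≤ (1 + ‖z‖) ^ m :=
        (pow_le_pow_left₀ (norm_nonneg _) (by linarith) i).trans
          (pow_le_pow_right₀ (by linarith [norm_nonneg z]) hi)
      have h2 : (-z * ((‖x‖ ^ 2 : ℝ) : ℂ)).re = -(z.re * ‖x‖ ^ 2) := by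
        rw [Complex.re_mul_ofReal]; simp
      rw [h2]
      gcongr
    · intro i hi1 hi
      refine (hb i hi x).trans ?_
      have h1 : 1 ≤ (1 + C₀) * (1 + ‖x‖) ^ l := by
        have := one_le_pow₀ (n := l) (show 1 ≤ 1 + ‖x‖ by linarith [norm_nonneg x])
        nlinarith
      calc C₀ * (1 + ‖x‖) ^ l ≤ (1 + C₀) * (1 + ‖x‖) ^ l := by gcongr; linarith
        _ ≤ _ := le_self_pow₀ h1 (by omega)
  have h1 : 1 + ‖x‖ ≤ 2 * (1 + ‖x‖ ^ 2) := by nlinarith [sq_nonneg (‖x‖ - 1), norm_nonneg x]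
  have h3 := hMb (‖x‖ ^ 2) (by positivity)
  rw [Real.rpow_natCast] at h3
  calc ‖x‖ ^ k * ‖iteratedFDeriv ℝ m (cgauss z) x‖
      ≤ (1 + ‖x‖) ^ k * (m.factorial * ((1 + ‖z‖) ^ m * Real.exp (-(z.re * ‖x‖ ^ 2))) *
        ((1 + C₀) * (1 + ‖x‖) ^ l) ^ m) := by
        gcongr
        · linarith
        · exact key
    _ = m.factorial * (1 + ‖z‖) ^ m * (1 + C₀) ^ m *
        ((1 + ‖x‖) ^ (k + l * m) * Real.exp (-(z.re * ‖x‖ ^ 2))) := by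
        rw [mul_pow, pow_add, pow_mul]; ring
    _ ≤ m.factorial * (1 + ‖z‖) ^ m * (1 + C₀) ^ m *
        ((2 * (1 + ‖x‖ ^ 2)) ^ (k + l * m) * Real.exp (-(z.re * ‖x‖ ^ 2))) := by gcongr
    _ = 2 ^ (k + l * m) * (m.factorial * (1 + ‖z‖) ^ m * (1 + C₀) ^ m *
        ((1 + ‖x‖ ^ 2) ^ (k + l * m) * Real.exp (-(z.re * ‖x‖ ^ 2)))) := by
        rw [mul_pow]; ring
    _ ≤ _ := by gcongr

/-- The complex Gaussian as a Schwartz function. -/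
def cgaussSchwartz (n : ℕ) {z : ℂ} (hz : 0 < z.re) :
    SchwartzMap (EuclideanSpace ℝ (Fin n)) ℂ where
  toFun := cgauss z
  smooth' := (contDiff_cexp_neg_mul_ofReal z).comp (contDiff_norm_sq ℝ)
  decay' := exists_pow_mul_norm_iteratedFDeriv_cgauss_le hz

/-- The exponential of a quadratic polynomial in `t`, with linear part spanned by two real
directions. -/
def quadExp {n : ℕ} (b α β : ℂ) (x ξ t : EuclideanSpace ℝ (Fin n)) : ℂ :=
  Complex.exp (-b * Complex.ofReal (‖t‖ ^ 2) + α * Complex.ofReal ⟪x, t⟫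
    + β * Complex.ofReal ⟪ξ, t⟫)

lemma quadExp_toLp {n : ℕ} (b α β : ℂ) (x ξ : EuclideanSpace ℝ (Fin n)) (v : Fin n → ℝ) :
    quadExp b α β x ξ (WithLp.toLp 2 v) = Complex.exp (-b * ∑ i, (v i : ℂ) ^ 2
      + ∑ i, (α * x i + β * ξ i) * v i) := by
  unfold quadExp
  congr 1
  rw [EuclideanSpace.real_norm_sq_eq]
  simp only [PiLp.inner_apply, RCLike.inner_apply, conj_trivial, Complex.ofReal_sum,
    Complex.ofReal_mul, Complex.ofReal_pow, add_assoc, Finset.mul_sum, ← Finset.sum_add_distrib]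
  refine Finset.sum_congr rfl fun i _ => by ring

lemma integrable_quadExp {n : ℕ} {b : ℂ} (hb : 0 < b.re) (α β : ℂ)
    (x ξ : EuclideanSpace ℝ (Fin n)) : Integrable (quadExp b α β x ξ) := by
  rw [← (PiLp.volume_preserving_toLp (Fin n)).integrable_comp_emb
    (MeasurableEquiv.toLp 2 _).measurableEmbedding]
  refine (GaussianFourier.integrable_cexp_neg_mul_sum_add hb
    (fun i => α * x i + β * ξ i)).congr (.of_forall fun v => ?_)
  exact (quadExp_toLp ..).symm

lemma integral_quadExp {n : ℕ} {b : ℂ} (hb : 0 < b.re) (α β : ℂ)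
    (x ξ : EuclideanSpace ℝ (Fin n)) : ∫ t, quadExp b α β x ξ t =
      (π / b) ^ ((n / 2 : ℝ) : ℂ) * Complex.exp ((α ^ 2 * Complex.ofReal (‖x‖ ^ 2)
        + 2 * α * β * Complex.ofReal ⟪x, ξ⟫ + β ^ 2 * Complex.ofReal (‖ξ‖ ^ 2)) / (4 * b)) := by
  rw [← (PiLp.volume_preserving_toLp (Fin n)).integral_comp
    (MeasurableEquiv.toLp 2 _).measurableEmbedding]
  simp_rw [quadExp_toLp]
  rw [GaussianFourier.integral_cexp_neg_mul_sum_add hb]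
  rw [EuclideanSpace.real_norm_sq_eq, EuclideanSpace.real_norm_sq_eq]
  congr 2
  · simp
  · simp only [PiLp.inner_apply, RCLike.inner_apply, conj_trivial, Complex.ofReal_sum,
      Complex.ofReal_mul, Complex.ofReal_pow, Finset.mul_sum, ← Finset.sum_add_distrib]
    congr 1
    refine Finset.sum_congr rfl fun i _ => by ring

/-- The short-time Fourier transform of a complex Gaussian, see `STFT_cgauss`. -/
def gaussSTFT {n : ℕ} (z : ℂ) (x ξ : EuclideanSpace ℝ (Fin n)) : ℂ :=
  (π / (1 + z)) ^ ((n / 2 : ℝ) : ℂ) * Complex.exp (-Complex.ofReal (‖x‖ ^ 2)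
    + (4 * Complex.ofReal (‖x‖ ^ 2) - 4 * Complex.I * Complex.ofReal ⟪x, ξ⟫
      - Complex.ofReal (‖ξ‖ ^ 2)) / (4 * (1 + z)))

/-- The integrand in the short-time Fourier transform of a complex Gaussian. -/
lemma STFT_integrand_cgauss {n : ℕ} (z : ℂ) (x ξ t : EuclideanSpace ℝ (Fin n)) :
    Complex.exp (-(Complex.I * Complex.ofReal ⟪ξ, t⟫)) * (starRingEnd ℂ) (gauss (t - x)) *
      cgauss z t =
    Complex.exp (-Complex.ofReal (‖x‖ ^ 2)) * quadExp (1 + z) 2 (-Complex.I) x ξ t := by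
  unfold gauss cgauss quadExp
  rw [Complex.conj_ofReal, Complex.ofReal_exp, ← Complex.exp_add, ← Complex.exp_add,
    ← Complex.exp_add, norm_sub_sq_real, real_inner_comm x t]
  congr 1
  push_cast
  ring

lemma STFT_cgauss {n : ℕ} {z : ℂ} (hz : 0 < z.re) (x ξ : EuclideanSpace ℝ (Fin n)) :
    STFT gauss (cgauss z) x ξ = gaussSTFT z x ξ := by
  unfold STFT gaussSTFT
  simp_rw [STFT_integrand_cgauss]
  rw [integral_const_mul, integral_quadExp (by simp; linarith), mul_left_comm, ← Complex.exp_add]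
  congr 2
  linear_combination Complex.ofReal (‖ξ‖ ^ 2) / (4 * (1 + z)) * Complex.I_sq

lemma STFT_sum_cgauss {n : ℕ} {ι : Type*} (s : Finset ι) (d z : ι → ℂ)
    (hz : ∀ j ∈ s, 0 < (z j).re) (x ξ : EuclideanSpace ℝ (Fin n)) :
    STFT gauss (fun t => ∑ j ∈ s, d j * cgauss (z j) t) x ξ =
      ∑ j ∈ s, d j * gaussSTFT (z j) x ξ := by
  have h : ∀ j ∈ s, d j * gaussSTFT (z j) x ξ = d j * STFT gauss (cgauss (z j)) x ξ :=
    fun j hj => by rw [STFT_cgauss (hz j hj)]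
  rw [Finset.sum_congr rfl h]
  unfold STFT
  simp_rw [← integral_const_mul]
  rw [← integral_finsetSum]
  · congr 1
    ext t
    rw [Finset.mul_sum]
    exact Finset.sum_congr rfl fun j _ => by ring
  · intro j hj
    simp_rw [STFT_integrand_cgauss]
    exact ((integrable_quadExp (by simp; linarith [hz j hj]) _ _ _ _).const_mul _).const_mul _

lemma cgauss_eq_quadExp {n : ℕ} (z : ℂ) (t : EuclideanSpace ℝ (Fin n)) :
    cgauss z t = quadExp z 0 0 0 0 t := by simp [cgauss, quadExp]

lemma FT_integrand_cgauss {n : ℕ} (z : ℂ) (ξ t : EuclideanSpace ℝ (Fin n)) :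
    Complex.exp (-(Complex.I * Complex.ofReal ⟪ξ, t⟫)) * cgauss z t =
      quadExp z 0 (-Complex.I) 0 ξ t := by
  unfold cgauss quadExp
  rw [← Complex.exp_add]
  congr 1
  simp only [zero_mul, add_zero]
  ring

lemma FT_cgauss {n : ℕ} {z : ℂ} (hz : 0 < z.re) (ξ : EuclideanSpace ℝ (Fin n)) :
    FT (cgauss z) ξ = (π / z) ^ ((n / 2 : ℝ) : ℂ) * cgauss (1 / (4 * z)) ξ := by
  unfold FT
  simp_rw [FT_integrand_cgauss]
  rw [integral_quadExp hz]
  unfold cgauss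
  congr 2
  linear_combination Complex.ofReal (‖ξ‖ ^ 2) / (4 * z) * Complex.I_sq

lemma FT_sum_cgauss {n : ℕ} {ι : Type*} (s : Finset ι) (d z : ι → ℂ)
    (hz : ∀ j ∈ s, 0 < (z j).re) (ξ : EuclideanSpace ℝ (Fin n)) :
    FT (fun t => ∑ j ∈ s, d j * cgauss (z j) t) ξ =
      ∑ j ∈ s, d j * ((π / z j) ^ ((n / 2 : ℝ) : ℂ) * cgauss (1 / (4 * z j)) ξ) := by
  rw [Finset.sum_congr rfl fun j hj => by rw [← FT_cgauss (hz j hj)]]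
  unfold FT
  simp_rw [← integral_const_mul]
  rw [← integral_finsetSum]
  · congr 1
    ext t
    rw [Finset.mul_sum]
    exact Finset.sum_congr rfl fun j _ => by ring
  · intro j hj
    simp_rw [FT_integrand_cgauss]
    exact (integrable_quadExp (hz j hj) _ _ _ _).const_mul _

/-- The constant produced by the Schrödinger propagator acting on a complex Gaussian. -/
def schrodCoeff (n : ℕ) (z : ℂ) : ℂ :=
  (((2 * π) ^ n)⁻¹ : ℝ) * ((π / z) ^ ((n / 2 : ℝ) : ℂ)
    * (π / (1 / (4 * z) + Complex.I)) ^ ((n / 2 : ℝ) : ℂ))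

lemma re_one_div_pos {z : ℂ} (hz : 0 < z.re) : 0 < (1 / z).re := by
  rw [one_div, Complex.inv_re]
  exact div_pos hz (Complex.normSq_pos.2 fun h => by simp [h] at hz)

lemma re_propagated_pos {z : ℂ} (hz : 0 < z.re) : 0 < (1 / (4 * z) + Complex.I).re := by
  have : 0 < (1 / (4 * z)).re := re_one_div_pos (by simpa using hz)
  simpa using this

lemma schrod_sum_cgauss {n : ℕ} {ι : Type*} (s : Finset ι) (d z : ι → ℂ)
    (hz : ∀ j ∈ s, 0 < (z j).re) (x : EuclideanSpace ℝ (Fin n)) :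
    schrod 1 (fun t => ∑ j ∈ s, d j * cgauss (z j) t) x =
      ∑ j ∈ s, d j * schrodCoeff n (z j) * cgauss (1 / (4 * (1 / (4 * z j) + Complex.I))) x := by
  have h : ∀ ξ : EuclideanSpace ℝ (Fin n),
      Complex.exp (Complex.I * Complex.ofReal ⟪x, ξ⟫) *
        Complex.exp (-(Complex.ofReal 1 * Complex.I * Complex.ofReal (‖ξ‖ ^ 2))) *
          FT (fun t => ∑ j ∈ s, d j * cgauss (z j) t) ξ =
      ∑ j ∈ s, d j * (π / z j) ^ ((n / 2 : ℝ) : ℂ) *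
        quadExp (1 / (4 * z j) + Complex.I) 0 Complex.I 0 x ξ := by
    intro ξ
    rw [FT_sum_cgauss s d z hz, Finset.mul_sum]
    refine Finset.sum_congr rfl fun j _ => ?_
    have : Complex.exp (Complex.I * Complex.ofReal ⟪x, ξ⟫) *
        Complex.exp (-(Complex.ofReal 1 * Complex.I * Complex.ofReal (‖ξ‖ ^ 2))) *
          cgauss (1 / (4 * z j)) ξ = quadExp (1 / (4 * z j) + Complex.I) 0 Complex.I 0 x ξ := by
      unfold cgauss quadExp
      rw [← Complex.exp_add, ← Complex.exp_add]
      congr 1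
      push_cast
      ring
    rw [← this]
    ring
  unfold schrod
  simp_rw [h]
  rw [integral_finsetSum, Finset.mul_sum]
  · refine Finset.sum_congr rfl fun j hj => ?_
    rw [integral_const_mul, integral_quadExp (re_propagated_pos (hz j hj))]
    have : Complex.exp ((0 ^ 2 * Complex.ofReal (‖(0 : EuclideanSpace ℝ (Fin n))‖ ^ 2)
        + 2 * 0 * Complex.I * Complex.ofReal ⟪0, x⟫
        + Complex.I ^ 2 * Complex.ofReal (‖x‖ ^ 2)) / (4 * (1 / (4 * z j) + Complex.I))) =
        cgauss (1 / (4 * (1 / (4 * z j) + Complex.I))) x := by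
      unfold cgauss
      congr 1
      rw [Complex.I_sq]
      ring
    rw [this, schrodCoeff]
    ring
  · intro j hj
    exact (integrable_quadExp (re_propagated_pos (hz j hj)) _ _ _ _).const_mul _

lemma ofReal_mul_four_add_I_ne_zero (a : ℝ) : (a : ℂ) * 4 + Complex.I ≠ 0 := fun h => by
  simpa using congrArg Complex.im h

lemma propagated_eq (a : ℝ) : 1 / (4 * ((a : ℂ) + Complex.I / 4)) + Complex.I =
    Complex.I * a / (a + Complex.I / 4) := by
  have h1 := ofReal_mul_four_add_I_ne_zero a
  rw [show (a : ℂ) + Complex.I / 4 = (a * 4 + Complex.I) / 4 by ring]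
  generalize hc : (a : ℂ) * 4 + Complex.I = c at h1
  rw [show (a : ℂ) = (c - Complex.I) / 4 by rw [← hc]; ring]
  field_simp
  linear_combination Complex.I_sq

/-- The propagator maps the chirped Gaussian of width parameter `a` to the one of width
parameter `1 / (16 a)` with the opposite chirp. -/
lemma one_div_propagated {a : ℝ} (ha : 0 < a) :
    1 / (4 * (1 / (4 * ((a : ℂ) + Complex.I / 4)) + Complex.I)) =
      ((1 / (16 * a) : ℝ) : ℂ) - Complex.I / 4 := by
  have h0 : (a : ℂ) ≠ 0 := by exact_mod_cast ha.ne'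
  have h1 := ofReal_mul_four_add_I_ne_zero a
  rw [propagated_eq]
  push_cast
  field_simp
  linear_combination (64 * a : ℂ) * Complex.I_sq

lemma norm_schrodCoeff (n : ℕ) {a : ℝ} (ha : 0 < a) :
    ‖schrodCoeff n ((a : ℂ) + Complex.I / 4)‖ = (4 * a) ^ (-(n / 2 : ℝ)) := by
  have h3 : ‖(a : ℂ) + Complex.I / 4‖ ≠ 0 := norm_ne_zero_iff.2 fun h =>
    ofReal_mul_four_add_I_ne_zero a (by linear_combination 4 * h)
  unfold schrodCoeff
  rw [propagated_eq, norm_mul, norm_mul, Complex.norm_cpow_real, Complex.norm_cpow_real,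
    ← Real.mul_rpow (norm_nonneg _) (norm_nonneg _)]
  have h4 : ‖(π : ℂ) / (a + Complex.I / 4)‖ * ‖(π : ℂ) / (Complex.I * a / (a + Complex.I / 4))‖ =
      (2 * π) ^ 2 * (4 * a)⁻¹ := by
    simp only [norm_div, norm_mul, Complex.norm_I, Complex.norm_real, Real.norm_eq_abs,
      abs_of_pos ha, abs_of_pos Real.pi_pos, one_mul]
    generalize ‖(a : ℂ) + Complex.I / 4‖ = r at h3
    field_simp
    norm_num
  rw [h4, Real.mul_rpow (by positivity) (by positivity), ← Real.rpow_natCast (2 * π) 2,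
    ← Real.rpow_mul (by positivity), Real.rpow_neg (by positivity),
    Real.inv_rpow (by positivity), Complex.norm_real, Real.norm_eq_abs, abs_of_pos (by positivity)]
  rw [show ((2 : ℕ) : ℝ) * (n / 2) = n by push_cast; ring, Real.rpow_natCast, ← mul_assoc,
    inv_mul_cancel₀ (by positivity), one_mul]

/-- The coefficients `(2^{jn} (j + 1))^{-1/P}`. -/
def dyadicCoeff (n : ℕ) (P : ℝ) (j : ℕ) : ℝ := ((2 : ℝ) ^ (j * n) * (j + 1)) ^ (-P⁻¹)

/-- A sum of Gaussians at dyadic scales, comparable to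
`|y|^{-n/P} (log |y|)^{-1/P}` for `1 ≪ |y| ≤ 2^J`. -/
def dyadicSum {n : ℕ} (P c : ℝ) (J : ℕ) (y : EuclideanSpace ℝ (Fin n)) : ℝ :=
  ∑ j ∈ Finset.range J, dyadicCoeff n P j * Real.exp (-(c / 4 ^ j * ‖y‖ ^ 2))

lemma dyadicCoeff_pos (n : ℕ) (P : ℝ) (j : ℕ) : 0 < dyadicCoeff n P j := by
  unfold dyadicCoeff; positivity

lemma dyadicSum_nonneg {n : ℕ} (P c : ℝ) (J : ℕ) (y : EuclideanSpace ℝ (Fin n)) :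
    0 ≤ dyadicSum P c J y :=
  Finset.sum_nonneg fun j _ => mul_nonneg (dyadicCoeff_pos n P j).le (Real.exp_pos _).le

lemma jp_pos {n : ℕ} (s : ℝ) (y : EuclideanSpace ℝ (Fin n)) : 0 < jp s y := by
  unfold jp; positivity

lemma integrable_exp_neg_mul_sq_norm {n : ℕ} {c : ℝ} (hc : 0 < c) :
    Integrable fun y : EuclideanSpace ℝ (Fin n) => Real.exp (-(c * ‖y‖ ^ 2)) := by
  have h := (integrable_quadExp (n := n) (b := (c : ℂ)) (by simpa using hc) 0 0 0 0).norm
  refine h.congr (.of_forall fun y => ?_)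
  change ‖quadExp (c : ℂ) 0 0 0 0 y‖ = Real.exp (-(c * ‖y‖ ^ 2))
  rw [← cgauss_eq_quadExp, cgauss, Complex.norm_exp, Complex.re_mul_ofReal]
  simp

lemma lintegral_exp_neg_mul_sq_norm {n : ℕ} {c : ℝ} (hc : 0 < c) :
    ∫⁻ y : EuclideanSpace ℝ (Fin n), ENNReal.ofReal (Real.exp (-(c * ‖y‖ ^ 2))) =
      ENNReal.ofReal ((π / c) ^ (n / 2 : ℝ)) := by
  rw [← ofReal_integral_eq_lintegral_ofReal (integrable_exp_neg_mul_sq_norm hc)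
    (.of_forall fun y => (Real.exp_pos _).le)]
  have := GaussianFourier.integral_rexp_neg_mul_sq_norm (V := EuclideanSpace ℝ (Fin n)) hc
  simp only [neg_mul, finrank_euclideanSpace, Fintype.card_fin] at this
  rw [this]

lemma lintegral_exp_neg_div_pow {n : ℕ} {c : ℝ} (hc : 0 < c) (j : ℕ) :
    ∫⁻ y : EuclideanSpace ℝ (Fin n), ENNReal.ofReal (Real.exp (-(c / 4 ^ j * ‖y‖ ^ 2))) =
      ENNReal.ofReal ((π / c) ^ (n / 2 : ℝ) * 2 ^ (j * n)) := by
  rw [lintegral_exp_neg_mul_sq_norm (by positivity)]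
  congr 1
  rw [show π / (c / 4 ^ j) = π / c * (2 ^ (j * 2)) by
    rw [mul_comm j 2, pow_mul]; norm_num; field_simp,
    Real.mul_rpow (by positivity) (by positivity), ← Real.rpow_natCast,
    ← Real.rpow_mul (by norm_num), ← Real.rpow_natCast]
  congr 2
  push_cast
  ring

lemma sum_rpow_le_rpow_sum_of_nonneg {ι : Type*} (s : Finset ι) {P : ℝ} (hP : 1 ≤ P) (f : ι → ℝ)
    (hf : ∀ i, 0 ≤ f i) : ∑ i ∈ s, f i ^ P ≤ (∑ i ∈ s, f i) ^ P := by
  classical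
  induction s using Finset.induction_on with
  | empty => simp [Real.zero_rpow (by linarith : P ≠ 0)]
  | insert a s ha ih =>
    rw [Finset.sum_insert ha, Finset.sum_insert ha]
    have h := NNReal.add_rpow_le_rpow_add ⟨f a, hf a⟩
      ⟨∑ i ∈ s, f i, Finset.sum_nonneg fun i _ => hf i⟩ hP
    have h' : f a ^ P + (∑ i ∈ s, f i) ^ P ≤ (f a + ∑ i ∈ s, f i) ^ P := by exact_mod_cast h
    linarith

lemma lintegral_dyadicSum_rpow_ge {n : ℕ} {P c : ℝ} (hP : 1 ≤ P) (hc : 0 < c) (J : ℕ) :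
    ENNReal.ofReal ((π / (c * P)) ^ (n / 2 : ℝ) * ∑ j ∈ Finset.range J, (1 / (j + 1) : ℝ)) ≤
      ∫⁻ y : EuclideanSpace ℝ (Fin n), ENNReal.ofReal (dyadicSum P c J y ^ P) := by
  have hP0 : 0 < P := by linarith
  have h1 : ∀ y : EuclideanSpace ℝ (Fin n),
      ∑ j ∈ Finset.range J, ENNReal.ofReal (((2 : ℝ) ^ (j * n) * (j + 1))⁻¹) *
        ENNReal.ofReal (Real.exp (-(c * P / 4 ^ j * ‖y‖ ^ 2))) ≤
      ENNReal.ofReal (dyadicSum P c J y ^ P) := by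
    intro y
    have h0 : ∀ (j : ℕ) (t : ℝ), ENNReal.ofReal (((2 : ℝ) ^ (j * n) * (j + 1))⁻¹) *
        ENNReal.ofReal t = ENNReal.ofReal (((2 : ℝ) ^ (j * n) * (j + 1))⁻¹ * t) :=
      fun j t => (ENNReal.ofReal_mul (by positivity)).symm
    simp_rw [h0]
    rw [← ENNReal.ofReal_sum_of_nonneg fun j _ => by positivity]
    refine ENNReal.ofReal_le_ofReal (le_trans (le_of_eq ?_) (sum_rpow_le_rpow_sum_of_nonneg _ hP _
      fun j => mul_nonneg (dyadicCoeff_pos n P j).le (Real.exp_pos _).le))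
    refine Finset.sum_congr rfl fun j _ => ?_
    rw [Real.mul_rpow (dyadicCoeff_pos n P j).le (Real.exp_pos _).le, dyadicCoeff,
      ← Real.rpow_mul (by positivity), ← Real.exp_mul]
    congr 1
    · rw [neg_mul, inv_mul_cancel₀ hP0.ne', Real.rpow_neg_one]
    · congr 1
      ring
  refine le_trans (le_of_eq ?_) (lintegral_mono h1)
  rw [lintegral_finsetSum _ fun j _ => by fun_prop, Finset.mul_sum,
    ENNReal.ofReal_sum_of_nonneg fun j _ => by positivity]
  refine Finset.sum_congr rfl fun j _ => ?_
  rw [lintegral_const_mul _ (by fun_prop), lintegral_exp_neg_div_pow (by positivity),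
    ← ENNReal.ofReal_mul (by positivity)]
  congr 1
  field_simp

lemma lpN_eq_eLpNorm {n : ℕ} {p : ℝ≥0∞} (hp : p ≠ 0) (F : EuclideanSpace ℝ (Fin n) → ℝ≥0∞) :
    lpN p F = eLpNorm F p volume := by
  unfold lpN
  split_ifs with h
  · subst h
    simp [eLpNormEssSup]
  · rw [eLpNorm_eq_lintegral_rpow_enorm_toReal hp h, one_div]
    simp

lemma lpN_ofReal_of_nonneg {n : ℕ} {P : ℝ} (hP : 0 ≤ P) {F : EuclideanSpace ℝ (Fin n) → ℝ}
    (hF : ∀ y, 0 ≤ F y) : lpN (ENNReal.ofReal P) (fun y => ENNReal.ofReal (F y)) =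
      (∫⁻ y, ENNReal.ofReal (F y ^ P)) ^ P⁻¹ := by
  unfold lpN
  rw [if_neg ENNReal.ofReal_ne_top, ENNReal.toReal_ofReal hP]
  simp_rw [ENNReal.ofReal_rpow_of_nonneg (hF _) hP]

/-- The `L^P` norms of the dyadic sums are unbounded. -/
lemma exists_lt_lpN_dyadicSum (n : ℕ) {P c : ℝ} (hP : 1 ≤ P) (hc : 0 < c) {M : ℝ≥0∞}
    (hM : M ≠ ∞) : ∃ J, M < lpN (ENNReal.ofReal P)
      (fun y : EuclideanSpace ℝ (Fin n) => ENNReal.ofReal (dyadicSum P c J y)) := by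
  have hP0 : 0 < P := by linarith
  have hK : 0 < (π / (c * P)) ^ (n / 2 : ℝ) := by positivity
  obtain ⟨J, hJ⟩ := ((Real.tendsto_sum_range_one_div_nat_succ_atTop.const_mul_atTop
    hK).eventually_gt_atTop (M.toReal ^ P)).exists
  refine ⟨J, ?_⟩
  rw [lpN_ofReal_of_nonneg hP0.le (dyadicSum_nonneg P c J), ENNReal.lt_rpow_inv_iff hP0]
  refine lt_of_lt_of_le ?_ (lintegral_dyadicSum_rpow_ge hP hc J)
  rw [← ENNReal.ofReal_toReal hM, ENNReal.ofReal_rpow_of_nonneg ENNReal.toReal_nonneg hP0.le]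
  refine (ENNReal.ofReal_lt_ofReal_iff_of_nonneg (by positivity)).2 ?_
  simpa [ENNReal.toReal_ofReal ENNReal.toReal_nonneg] using hJ

lemma sum_div_one_add_sq_le {A θ : ℝ} (hA : 0 < A) (hθ : 1 < θ) (J : ℕ) :
    ∑ j ∈ Finset.range J, A / θ ^ j / (1 + A / θ ^ j) ^ 2 ≤ θ / (θ - 1) := by
  have hθ0 : 0 < θ := by linarith
  have hθ1 : 0 < θ - 1 := by linarith
  set F : ℕ → ℝ := fun j => A / θ ^ j / (1 + A / θ ^ j) with hF
  have h1 : ∀ j, A / θ ^ j / (1 + A / θ ^ j) ^ 2 ≤ θ / (θ - 1) * (F j - F (j + 1)) := by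
    intro j
    have hY : 0 < A / θ ^ j := by positivity
    have h2 : A / θ ^ (j + 1) = A / θ ^ j / θ := by rw [pow_succ, div_div]
    simp only [hF, h2]
    generalize A / θ ^ j = Y at hY
    have h3 : θ / (θ - 1) * (Y / (1 + Y) - Y / θ / (1 + Y / θ)) =
        Y / (1 + Y) * (θ / (θ + Y)) := by
      field_simp
      ring
    rw [h3, pow_two, ← div_div, div_eq_mul_inv]
    gcongr
    rw [inv_eq_one_div, div_le_div_iff₀ (by positivity) (by positivity)]
    nlinarith
  calc _ ≤ ∑ j ∈ Finset.range J, θ / (θ - 1) * (F j - F (j + 1)) :=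
        Finset.sum_le_sum fun j _ => h1 j
    _ = θ / (θ - 1) * (F 0 - F J) := by rw [← Finset.mul_sum, Finset.sum_range_sub']
    _ ≤ θ / (θ - 1) * 1 := by
        have hJ : 0 ≤ F J := by simp only [hF]; positivity
        have h0 : F 0 ≤ 1 := by
          simp only [hF]
          rw [div_le_one (by positivity)]
          linarith
        gcongr
        linarith
    _ = _ := mul_one _

lemma jp_mul_exp_le {σ c M : ℝ} (hσ : 0 < σ)
    (hM : ∀ v : ℝ, 0 ≤ v → (1 + v) ^ σ * Real.exp (-(c / 2 * v)) ≤ M) {n : ℕ}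
    (y : EuclideanSpace ℝ (Fin n)) (j : ℕ) :
    jp σ y * Real.exp (-(c / 4 ^ j * ‖y‖ ^ 2)) ≤ 4 * M * ((2 : ℝ) ^ σ) ^ j *
      (jp σ y / ((2 : ℝ) ^ σ) ^ j / (1 + jp σ y / ((2 : ℝ) ^ σ) ^ j) ^ 2 *
        Real.exp (-(c / 2 / 4 ^ j * ‖y‖ ^ 2))) := by
  set v : ℝ := ‖y‖ ^ 2 / 4 ^ j with hv
  have hv0 : 0 ≤ v := by positivity
  have hθ : ((2 : ℝ) ^ σ) ^ j = ((4 : ℝ) ^ j) ^ (σ / 2) := by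
    rw [show (4 : ℝ) = 2 ^ 2 by norm_num, ← pow_mul, ← Real.rpow_natCast, ← Real.rpow_natCast,
      ← Real.rpow_mul (by norm_num), ← Real.rpow_mul (by norm_num)]
    congr 1
    push_cast
    ring
  have hY : jp σ y / ((2 : ℝ) ^ σ) ^ j ≤ (1 + v) ^ (σ / 2) := by
    rw [hθ, jp, ← Real.div_rpow (by positivity) (by positivity)]
    refine Real.rpow_le_rpow (by positivity) ?_ (by positivity)
    rw [hv, add_div]
    gcongr
    exact div_le_one_of_le₀ (one_le_pow₀ (by norm_num)) (by positivity)
  have hθ0 : 0 < ((2 : ℝ) ^ σ) ^ j := by positivity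
  have hA : jp σ y = ((2 : ℝ) ^ σ) ^ j * (jp σ y / ((2 : ℝ) ^ σ) ^ j) := by field_simp
  have hY0 : 0 < jp σ y / ((2 : ℝ) ^ σ) ^ j := div_pos (jp_pos σ y) hθ0
  have hexp1 : Real.exp (-(c / 4 ^ j * ‖y‖ ^ 2)) =
      Real.exp (-(c / 2 * v)) * Real.exp (-(c / 2 / 4 ^ j * ‖y‖ ^ 2)) := by
    rw [← Real.exp_add, hv]
    congr 1
    ring
  rw [hexp1]
  have hE : 0 ≤ Real.exp (-(c / 2 / 4 ^ j * ‖y‖ ^ 2)) := (Real.exp_pos _).le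
  generalize Real.exp (-(c / 2 / 4 ^ j * ‖y‖ ^ 2)) = E at hE ⊢
  generalize jp σ y / ((2 : ℝ) ^ σ) ^ j = Y at *
  have h1 : (1 : ℝ) ≤ (1 + v) ^ (σ / 2) := Real.one_le_rpow (by linarith) (by positivity)
  have h2 : (1 + Y) ^ 2 ≤ 4 * (1 + v) ^ σ := by
    calc (1 + Y) ^ 2 ≤ (2 * (1 + v) ^ (σ / 2)) ^ 2 := by gcongr; linarith
      _ = 4 * (1 + v) ^ σ := by
        rw [mul_pow, ← Real.rpow_natCast ((1 + v) ^ (σ / 2)), ← Real.rpow_mul (by linarith)]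
        norm_num
  have h3 : Real.exp (-(c / 2 * v)) ≤ 4 * M / (1 + Y) ^ 2 := by
    rw [le_div_iff₀ (by positivity)]
    calc Real.exp (-(c / 2 * v)) * (1 + Y) ^ 2
        ≤ Real.exp (-(c / 2 * v)) * (4 * (1 + v) ^ σ) := by gcongr
      _ = 4 * ((1 + v) ^ σ * Real.exp (-(c / 2 * v))) := by ring
      _ ≤ 4 * M := by gcongr; exact hM v hv0
  calc jp σ y * (Real.exp (-(c / 2 * v)) * E)
      ≤ jp σ y * (4 * M / (1 + Y) ^ 2 * E) := by gcongr; exact (jp_pos σ y).le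
    _ = _ := by rw [hA]; ring

lemma dyadicCoeff_mul_pow (n : ℕ) (P i : ℝ) (j : ℕ) :
    dyadicCoeff n P j * ((2 : ℝ) ^ (n * (P⁻¹ - i))) ^ j =
      ((2 : ℝ) ^ (j * n)) ^ (-i) * ((j : ℝ) + 1) ^ (-P⁻¹) := by
  rw [dyadicCoeff, Real.mul_rpow (by positivity) (by positivity), mul_right_comm]
  congr 1
  rw [← Real.rpow_natCast 2, ← Real.rpow_natCast _ j, ← Real.rpow_mul (by norm_num),
    ← Real.rpow_mul (by norm_num), ← Real.rpow_mul (by norm_num), ← Real.rpow_add (by norm_num)]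
  congr 1
  push_cast
  ring

/-- The terms of the weighted sum controlling `jp σ * dyadicSum P c J`. -/
def dyadicKernel {n : ℕ} (σ c : ℝ) (y : EuclideanSpace ℝ (Fin n)) (j : ℕ) : ℝ :=
  jp σ y / ((2 : ℝ) ^ σ) ^ j / (1 + jp σ y / ((2 : ℝ) ^ σ) ^ j) ^ 2 *
    Real.exp (-(c / 2 / 4 ^ j * ‖y‖ ^ 2))

lemma dyadicKernel_nonneg {n : ℕ} (σ c : ℝ) (y : EuclideanSpace ℝ (Fin n)) (j : ℕ) :
    0 ≤ dyadicKernel σ c y j := by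
  have := jp_pos σ y
  unfold dyadicKernel
  positivity

lemma dyadicKernel_le_exp {n : ℕ} (σ c : ℝ) (y : EuclideanSpace ℝ (Fin n)) (j : ℕ) :
    dyadicKernel σ c y j ≤ Real.exp (-(c / 2 / 4 ^ j * ‖y‖ ^ 2)) := by
  have hY : 0 < jp σ y / ((2 : ℝ) ^ σ) ^ j := div_pos (jp_pos σ y) (by positivity)
  unfold dyadicKernel
  refine mul_le_of_le_one_left (Real.exp_pos _).le ?_
  rw [div_le_one (by positivity)]
  nlinarith

lemma sum_dyadicKernel_le {n : ℕ} {σ c : ℝ} (hσ : 0 < σ) (hc : 0 < c)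
    (y : EuclideanSpace ℝ (Fin n)) (J : ℕ) :
    ∑ j ∈ Finset.range J, dyadicKernel σ c y j ≤ (2 : ℝ) ^ σ / ((2 : ℝ) ^ σ - 1) := by
  refine le_trans (Finset.sum_le_sum fun j _ => ?_) (sum_div_one_add_sq_le (jp_pos σ y)
    (Real.one_lt_rpow (by norm_num) hσ) J)
  have := jp_pos σ y
  refine mul_le_of_le_one_right (by positivity) ?_
  rw [Real.exp_le_one_iff, neg_nonpos]
  positivity

lemma exists_jp_mul_dyadicSum_le (n : ℕ) {P c i : ℝ} (hσ : 0 < n * (P⁻¹ - i)) (hc : 0 < c) :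
    ∃ M : ℝ, 0 < M ∧ ∀ (J : ℕ) (y : EuclideanSpace ℝ (Fin n)),
      jp (n * (P⁻¹ - i)) y * dyadicSum P c J y ≤
        M * ∑ j ∈ Finset.range J, dyadicKernel (n * (P⁻¹ - i)) c y j *
          (((2 : ℝ) ^ (j * n)) ^ (-i) * ((j : ℝ) + 1) ^ (-P⁻¹)) := by
  obtain ⟨M, hM0, hM⟩ := exists_one_add_rpow_mul_exp_neg_le _ hσ.le (half_pos hc)
  refine ⟨4 * M, by positivity, fun J y => ?_⟩
  rw [dyadicSum, Finset.mul_sum, Finset.mul_sum]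
  refine Finset.sum_le_sum fun j _ => ?_
  rw [← dyadicCoeff_mul_pow]
  have h := mul_le_mul_of_nonneg_left (jp_mul_exp_le hσ hM y j) (dyadicCoeff_pos n P j).le
  calc _ = _ := by ring
    _ ≤ _ := h
    _ = _ := by rw [dyadicKernel]; ring

lemma rpow_weighted_sum_le {ι : Type*} (s : Finset ι) {Q S : ℝ} (hQ : 1 ≤ Q) (w f : ι → ℝ)
    (hw : ∀ i, 0 ≤ w i) (hf : ∀ i, 0 ≤ f i) (hS : ∑ i ∈ s, w i ≤ S) :
    (∑ i ∈ s, w i * f i) ^ Q ≤ S ^ (Q - 1) * ∑ i ∈ s, w i * f i ^ Q := by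
  have hQ0 : 0 < Q := by linarith
  have h0 : 0 ≤ ∑ i ∈ s, w i * f i ^ Q :=
    Finset.sum_nonneg fun i _ => mul_nonneg (hw i) (Real.rpow_nonneg (hf i) _)
  have hw0 : 0 ≤ ∑ i ∈ s, w i := Finset.sum_nonneg fun i _ => hw i
  calc (∑ i ∈ s, w i * f i) ^ Q
      ≤ ((∑ i ∈ s, w i) ^ (1 - Q⁻¹) * (∑ i ∈ s, w i * f i ^ Q) ^ Q⁻¹) ^ Q :=
        Real.rpow_le_rpow (Finset.sum_nonneg fun i _ => mul_nonneg (hw i) (hf i))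
          (Real.inner_le_weight_mul_Lp_of_nonneg s hQ w f hw hf) hQ0.le
    _ = (∑ i ∈ s, w i) ^ (Q - 1) * ∑ i ∈ s, w i * f i ^ Q := by
        rw [Real.mul_rpow (by positivity) (by positivity), ← Real.rpow_mul hw0,
          ← Real.rpow_mul h0, inv_mul_cancel₀ hQ0.ne', Real.rpow_one, sub_mul,
          inv_mul_cancel₀ hQ0.ne', one_mul]
    _ ≤ _ := by gcongr

/-- The weighted `L^Q` norms of the dyadic sums are bounded. -/
lemma exists_lpN_jp_mul_dyadicSum_le {n : ℕ} (hn : 1 ≤ n) {P c : ℝ} (hP : 1 ≤ P) (hc : 0 < c)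
    {Q : ℝ≥0∞} (hPQ : ENNReal.ofReal P < Q) :
    ∃ M : ℝ≥0∞, M ≠ ∞ ∧ ∀ J, lpN Q (fun y : EuclideanSpace ℝ (Fin n) =>
      ENNReal.ofReal (jp (n * (P⁻¹ - Q⁻¹.toReal)) y * dyadicSum P c J y)) ≤ M := by
  have hP0 : 0 < P := by linarith
  have hn0 : (0 : ℝ) < n := by exact_mod_cast hn
  have hi : Q⁻¹.toReal < P⁻¹ := by
    rw [← ENNReal.toReal_ofReal (inv_nonneg.2 hP0.le), ENNReal.ofReal_inv_of_pos hP0]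
    exact (ENNReal.toReal_lt_toReal (by simpa using (bot_le.trans_lt hPQ).ne')
      (by simpa using hP0)).2 (ENNReal.inv_lt_inv.2 hPQ)
  have hσ : 0 < n * (P⁻¹ - Q⁻¹.toReal) := mul_pos hn0 (by linarith)
  obtain ⟨M, hM0, hM⟩ := exists_jp_mul_dyadicSum_le n hσ hc
  set σ := n * (P⁻¹ - Q⁻¹.toReal) with hσdef
  set S := (2 : ℝ) ^ σ / ((2 : ℝ) ^ σ - 1) with hS
  have hS0 : 0 < S := by
    have := Real.one_lt_rpow (show (1 : ℝ) < 2 by norm_num) hσ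
    have : 0 < (2 : ℝ) ^ σ - 1 := by linarith
    positivity
  by_cases hQ : Q = ∞
  · refine ⟨ENNReal.ofReal (M * S), ENNReal.ofReal_ne_top, fun J => ?_⟩
    rw [lpN, if_pos hQ]
    refine essSup_le_of_ae_le _ (.of_forall fun y => ENNReal.ofReal_le_ofReal ?_)
    refine (hM J y).trans ?_
    gcongr
    refine le_trans (Finset.sum_le_sum fun j _ => ?_) (sum_dyadicKernel_le hσ hc y J)
    refine mul_le_of_le_one_right (dyadicKernel_nonneg ..) ?_
    rw [hQ]
    simp only [ENNReal.inv_top, ENNReal.toReal_zero, neg_zero, Real.rpow_zero, one_mul]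
    exact Real.rpow_le_one_of_one_le_of_nonpos (by linarith [Nat.cast_nonneg (α := ℝ) j])
      (by simpa using hP0.le)
  · obtain ⟨q, rfl⟩ : ∃ q : ℝ, Q = ENNReal.ofReal q := ⟨Q.toReal, (ENNReal.ofReal_toReal hQ).symm⟩
    have hPq : P < q := (ENNReal.ofReal_lt_ofReal_iff_of_nonneg hP0.le).1 hPQ
    have hq0 : 0 < q := by linarith
    have hqi : (ENNReal.ofReal q)⁻¹.toReal = q⁻¹ := by
      rw [ENNReal.toReal_inv, ENNReal.toReal_ofReal hq0.le]
    rw [hqi] at hM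
    have hsum : Summable fun j : ℕ => ((j : ℝ) + 1) ^ (-(q / P)) := by
      have h := (Real.summable_one_div_nat_add_rpow 1 (q / P)).2 ((one_lt_div hP0).2 hPq)
      refine h.congr fun j => ?_
      rw [abs_of_pos (by positivity), Real.rpow_neg (by positivity), one_div]
    set D := ∑' j : ℕ, ((j : ℝ) + 1) ^ (-(q / P)) with hD
    set B := M ^ q * S ^ (q - 1) with hB
    have hB0 : 0 < B := by positivity
    set G := (π / (c / 2)) ^ (n / 2 : ℝ) with hG
    refine ⟨(ENNReal.ofReal (B * (G * D))) ^ q⁻¹, ENNReal.rpow_ne_top_of_nonneg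
      (by positivity) ENNReal.ofReal_ne_top, fun J => ?_⟩
    rw [lpN_ofReal_of_nonneg hq0.le fun y =>
      mul_nonneg (jp_pos _ y).le (dyadicSum_nonneg P c J y)]
    refine ENNReal.rpow_le_rpow ?_ (by positivity)
    have hpt : ∀ y : EuclideanSpace ℝ (Fin n), ENNReal.ofReal ((jp σ y * dyadicSum P c J y) ^ q) ≤
        ENNReal.ofReal B * ∑ j ∈ Finset.range J,
          ENNReal.ofReal (Real.exp (-(c / 2 / 4 ^ j * ‖y‖ ^ 2))) *
            ENNReal.ofReal (((2 : ℝ) ^ (j * n))⁻¹ * ((j : ℝ) + 1) ^ (-(q / P))) := by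
      intro y
      simp_rw [← ENNReal.ofReal_mul (Real.exp_pos _).le]
      rw [← ENNReal.ofReal_sum_of_nonneg fun j _ => by positivity, ← ENNReal.ofReal_mul hB0.le]
      refine ENNReal.ofReal_le_ofReal ?_
      have hγ : ∀ j : ℕ, 0 ≤ ((2 : ℝ) ^ (j * n)) ^ (-q⁻¹) * ((j : ℝ) + 1) ^ (-P⁻¹) :=
        fun j => by positivity
      calc (jp σ y * dyadicSum P c J y) ^ q
          ≤ (M * ∑ j ∈ Finset.range J, dyadicKernel σ c y j *
            (((2 : ℝ) ^ (j * n)) ^ (-q⁻¹) * ((j : ℝ) + 1) ^ (-P⁻¹))) ^ q :=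
            Real.rpow_le_rpow (mul_nonneg (jp_pos _ y).le (dyadicSum_nonneg P c J y)) (hM J y)
              hq0.le
        _ = M ^ q * (∑ j ∈ Finset.range J, dyadicKernel σ c y j *
            (((2 : ℝ) ^ (j * n)) ^ (-q⁻¹) * ((j : ℝ) + 1) ^ (-P⁻¹))) ^ q :=
            Real.mul_rpow hM0.le (Finset.sum_nonneg fun j _ =>
              mul_nonneg (dyadicKernel_nonneg σ c y j) (hγ j))
        _ ≤ M ^ q * (S ^ (q - 1) * ∑ j ∈ Finset.range J, dyadicKernel σ c y j *
            (((2 : ℝ) ^ (j * n)) ^ (-q⁻¹) * ((j : ℝ) + 1) ^ (-P⁻¹)) ^ q) := by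
            gcongr
            exact rpow_weighted_sum_le _ (by linarith) _ _ (dyadicKernel_nonneg σ c y) hγ
              (sum_dyadicKernel_le hσ hc y J)
        _ ≤ M ^ q * (S ^ (q - 1) * ∑ j ∈ Finset.range J,
            Real.exp (-(c / 2 / 4 ^ j * ‖y‖ ^ 2)) *
            (((2 : ℝ) ^ (j * n))⁻¹ * ((j : ℝ) + 1) ^ (-(q / P)))) := by
            gcongr with j _
            · exact dyadicKernel_le_exp σ c y j
            · rw [Real.mul_rpow (by positivity) (by positivity), ← Real.rpow_mul (by positivity),
                ← Real.rpow_mul (by positivity), neg_mul, inv_mul_cancel₀ hq0.ne',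
                Real.rpow_neg_one]
              refine le_of_eq ?_
              congr 2
              field_simp
        _ = _ := by rw [hB]; ring
    refine (lintegral_mono hpt).trans ?_
    rw [lintegral_const_mul _ (by fun_prop), lintegral_finsetSum _ fun j _ => by fun_prop,
      ENNReal.ofReal_mul hB0.le]
    gcongr
    have hterm : ∀ j ∈ Finset.range J, ∫⁻ y : EuclideanSpace ℝ (Fin n),
        ENNReal.ofReal (Real.exp (-(c / 2 / 4 ^ j * ‖y‖ ^ 2))) *
          ENNReal.ofReal (((2 : ℝ) ^ (j * n))⁻¹ * ((j : ℝ) + 1) ^ (-(q / P))) =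
        ENNReal.ofReal (G * ((j : ℝ) + 1) ^ (-(q / P))) := by
      intro j _
      rw [lintegral_mul_const _ (by fun_prop), lintegral_exp_neg_div_pow (by positivity),
        ← ENNReal.ofReal_mul (by positivity)]
      congr 1
      rw [← hG]
      field_simp
    rw [Finset.sum_congr rfl hterm, ← ENNReal.ofReal_sum_of_nonneg fun j _ => by positivity,
      ← Finset.mul_sum]
    refine ENNReal.ofReal_le_ofReal ?_
    gcongr
    exact hsum.sum_le_tsum _ fun j _ => by positivity

/-- Superpositions of chirped Gaussians, together with the short-time Fourier transforms of
themselves and of their Schrödinger evolutions. -/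
lemma exists_schwartz_STFT_eq {n : ℕ} {a : ℕ → ℝ} (ha : ∀ j, 0 < a j) (d : ℕ → ℂ) (J : ℕ) :
    ∃ f : SchwartzMap (EuclideanSpace ℝ (Fin n)) ℂ,
      (∀ x ξ, STFT gauss f x ξ =
        ∑ j ∈ Finset.range J, d j * gaussSTFT (a j + Complex.I / 4) x ξ) ∧
      ∀ x ξ, STFT gauss (schrod 1 f) x ξ =
        ∑ j ∈ Finset.range J, d j * schrodCoeff n (a j + Complex.I / 4) *
          gaussSTFT (((1 / (16 * a j) : ℝ) : ℂ) - Complex.I / 4) x ξ := by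
  have hz : ∀ j, 0 < ((a j : ℂ) + Complex.I / 4).re := fun j => by simpa using ha j
  have hw : ∀ j, 0 < (((1 / (16 * a j) : ℝ) : ℂ) - Complex.I / 4).re := fun j => by
    have := ha j
    simp only [Complex.sub_re, Complex.ofReal_re, Complex.div_ofNat_re, Complex.I_re, zero_div,
      sub_zero]
    positivity
  have hf : ⇑(∑ j ∈ Finset.range J, d j • cgaussSchwartz n (hz j)) =
      fun t => ∑ j ∈ Finset.range J, d j * cgauss ((a j : ℂ) + Complex.I / 4) t := by
    ext t
    rw [sum_apply]
    rfl
  refine ⟨∑ j ∈ Finset.range J, d j • cgaussSchwartz n (hz j), fun x ξ => ?_, fun x ξ => ?_⟩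
  · rw [hf, STFT_sum_cgauss _ _ _ fun j _ => hz j]
  · have hs : schrod 1 (fun t : EuclideanSpace ℝ (Fin n) =>
          ∑ j ∈ Finset.range J, d j * cgauss ((a j : ℂ) + Complex.I / 4) t) =
        fun t => ∑ j ∈ Finset.range J, d j * schrodCoeff n (a j + Complex.I / 4) *
          cgauss (((1 / (16 * a j) : ℝ) : ℂ) - Complex.I / 4) t := by
      ext t
      rw [schrod_sum_cgauss _ _ _ fun j _ => hz j]
      exact Finset.sum_congr rfl fun j _ => by rw [one_div_propagated (ha j)]
    rw [hf, hs, STFT_sum_cgauss _ _ _ fun j _ => hw j]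

lemma norm_gaussSTFT_le {n : ℕ} {a : ℝ} (ha : 0 < a) (x ξ : EuclideanSpace ℝ (Fin n)) :
    ‖gaussSTFT ((a : ℂ) + Complex.I / 4) x ξ‖ ≤ (π / (1 + a)) ^ (n / 2 : ℝ) *
      Real.exp (-‖x‖ ^ 2 + ((4 * ‖x‖ ^ 2 - ‖ξ‖ ^ 2) * (1 + a) - ⟪x, ξ⟫) /
        (4 * ((1 + a) ^ 2 + 1 / 16))) := by
  rw [gaussSTFT, norm_mul, Complex.norm_cpow_real, Complex.norm_exp]
  refine mul_le_mul ?_ (le_of_eq ?_) (Real.exp_pos _).le (by positivity)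
  · refine Real.rpow_le_rpow (norm_nonneg _) ?_ (by positivity)
    rw [norm_div, Complex.norm_real, Real.norm_eq_abs, abs_of_pos Real.pi_pos]
    gcongr
    calc 1 + a ≤ |((1 : ℂ) + (a + Complex.I / 4)).re| := by
          simpa using le_abs_self (1 + a)
      _ ≤ _ := Complex.abs_re_le_norm _
  · congr 1
    rw [Complex.add_re, Complex.neg_re, Complex.ofReal_re, Complex.div_re]
    have h2 : Complex.normSq (4 * (1 + ((a : ℂ) + Complex.I / 4))) =
        16 * ((1 + a) ^ 2 + 1 / 16) := by
      rw [Complex.normSq_apply]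
      simp
      ring
    rw [h2]
    simp [-Complex.ofReal_pow]
    field_simp
    ring

lemma abs_inner_le_half {n : ℕ} (x y : EuclideanSpace ℝ (Fin n)) :
    |⟪x, y⟫| ≤ (‖x‖ ^ 2 + ‖y‖ ^ 2) / 2 := by
  have h := abs_real_inner_le_norm x y
  nlinarith [sq_nonneg (‖x‖ - ‖y‖)]

/-- The chirped Gaussians of width at most one concentrate near the frequency axis. -/
lemma norm_gaussSTFT_le_of_one_le {n : ℕ} {a : ℝ} (ha : 1 ≤ a) (x ξ : EuclideanSpace ℝ (Fin n)) :
    ‖gaussSTFT ((a : ℂ) + Complex.I / 4) x ξ‖ ≤ (π / a) ^ (n / 2 : ℝ) *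
      (Real.exp (-(1 / 4 * ‖x‖ ^ 2)) * Real.exp (-(1 / 16 / a * ‖ξ‖ ^ 2))) := by
  refine (norm_gaussSTFT_le (by linarith) x ξ).trans ?_
  rw [← Real.exp_add]
  have hin := (abs_le.1 (abs_inner_le_half x ξ)).1
  have hX := sq_nonneg ‖x‖
  have hY := sq_nonneg ‖ξ‖
  generalize ‖x‖ ^ 2 = X at *
  generalize ‖ξ‖ ^ 2 = Y at *
  refine mul_le_mul (by gcongr; linarith) (Real.exp_le_exp.2 ?_) (Real.exp_pos _).le
    (by positivity)
  have hD : 0 < 4 * ((1 + a) ^ 2 + 1 / 16) := by positivity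
  have h1 : 1 / 16 / a * Y * (4 * ((1 + a) ^ 2 + 1 / 16)) ≤ (a - 1 / 2 + 1) * Y := by
    rw [show 1 / 16 / a * Y * (4 * ((1 + a) ^ 2 + 1 / 16)) =
      ((1 + a) ^ 2 + 1 / 16) / (4 * a) * Y by field_simp; ring]
    gcongr
    rw [div_le_iff₀ (by linarith)]
    nlinarith
  rw [← le_sub_iff_add_le', div_le_iff₀ hD]
  have h2 : 0 ≤ X * (a - 1) := mul_nonneg hX (by linarith)
  have h3 : 0 ≤ X * (a - 1) * a := mul_nonneg h2 (by linarith)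
  nlinarith

/-- The chirped Gaussians of large width concentrate near the antidiagonal `ξ = -x / 2`. -/
lemma norm_gaussSTFT_le_of_le {n : ℕ} {a : ℝ} (ha : 0 < a) (ha' : a ≤ 1 / 16)
    (x ξ : EuclideanSpace ℝ (Fin n)) :
    ‖gaussSTFT ((a : ℂ) + Complex.I / 4) x ξ‖ ≤ π ^ (n / 2 : ℝ) *
      (Real.exp (-(1 / 16 * ‖ξ + (1 / 2 : ℝ) • x‖ ^ 2)) * Real.exp (-(a / 4 * ‖x‖ ^ 2))) := by
  refine (norm_gaussSTFT_le ha x ξ).trans ?_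
  rw [← Real.exp_add]
  set u := ξ + (1 / 2 : ℝ) • x with hu
  have hξ : ξ = u - (1 / 2 : ℝ) • x := by rw [hu, add_sub_cancel_right]
  have hin := (abs_le.1 (abs_inner_le_half x u)).2
  rw [hξ, norm_sub_sq_real, inner_sub_right, inner_smul_right, inner_smul_right, norm_smul,
    real_inner_self_eq_norm_sq, mul_pow, real_inner_comm x u, Real.norm_eq_abs,
    abs_of_pos (by norm_num)]
  have hX := sq_nonneg ‖x‖
  have hY := sq_nonneg ‖u‖
  generalize ‖x‖ ^ 2 = X at *
  generalize ‖u‖ ^ 2 = Y at *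
  generalize ⟪x, u⟫ = r at *
  refine mul_le_mul ?_ (Real.exp_le_exp.2 ?_) (Real.exp_pos _).le (by positivity)
  · gcongr
    rw [div_le_iff₀ (by positivity)]
    nlinarith [Real.pi_pos]
  have hD : 0 < 4 * ((1 + a) ^ 2 + 1 / 16) := by positivity
  rw [← le_sub_iff_add_le', div_le_iff₀ hD]
  nlinarith [mul_nonneg hX ha.le, mul_nonneg hY ha.le, mul_nonneg (mul_nonneg hX ha.le) ha.le,
    mul_nonneg (mul_nonneg hX ha.le) (sub_nonneg.2 ha'), mul_nonneg ha.le (sub_nonneg.2 hin),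
    mul_nonneg hY (sub_nonneg.2 ha'), mul_nonneg (mul_nonneg hY ha.le) (sub_nonneg.2 ha'),
    mul_nonneg (mul_nonneg (mul_nonneg hX ha.le) ha.le) (sub_nonneg.2 ha')]

lemma lpN_mono {n : ℕ} (p : ℝ≥0∞) {F G : EuclideanSpace ℝ (Fin n) → ℝ≥0∞} (h : ∀ x, F x ≤ G x) :
    lpN p F ≤ lpN p G := by
  unfold lpN
  split_ifs
  · exact essSup_mono_ae (Filter.Eventually.of_forall h)
  · gcongr with x
    exact h x

lemma lpN_const_mul {n : ℕ} {p c : ℝ≥0∞} (hp : p ≠ 0) (hc : c ≠ ∞)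
    (F : EuclideanSpace ℝ (Fin n) → ℝ≥0∞) : lpN p (fun x => c * F x) = c * lpN p F := by
  unfold lpN
  split_ifs with h
  · exact ENNReal.essSup_const_mul
  · have hp0 : 0 < p.toReal := ENNReal.toReal_pos hp h
    simp_rw [ENNReal.mul_rpow_of_nonneg _ _ hp0.le]
    rw [lintegral_const_mul' _ _ (ENNReal.rpow_ne_top_of_nonneg hp0.le hc),
      ENNReal.mul_rpow_of_nonneg _ _ (inv_nonneg.2 hp0.le), ← ENNReal.rpow_mul,
      mul_inv_cancel₀ hp0.ne', ENNReal.rpow_one]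

lemma lpN_exp_neg_mul_sq_norm_ne_top {n : ℕ} {P c : ℝ} (hP : 0 < P) (hc : 0 < c) :
    lpN (ENNReal.ofReal P) (fun x : EuclideanSpace ℝ (Fin n) =>
      ENNReal.ofReal (Real.exp (-(c * ‖x‖ ^ 2)))) ≠ ∞ := by
  rw [lpN_ofReal_of_nonneg hP.le fun x => (Real.exp_pos _).le]
  refine ENNReal.rpow_ne_top_of_nonneg (inv_nonneg.2 hP.le) ?_
  have h : ∀ x : EuclideanSpace ℝ (Fin n),
      Real.exp (-(c * ‖x‖ ^ 2)) ^ P = Real.exp (-(c * P * ‖x‖ ^ 2)) := fun x => by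
    rw [← Real.exp_mul]
    congr 1
    ring
  simp_rw [h]
  exact (integrable_exp_neg_mul_sq_norm (mul_pos hc hP)).lintegral_lt_top.ne

lemma lpN_ofReal_comp_add {n : ℕ} (P : ℝ) (F : EuclideanSpace ℝ (Fin n) → ℝ≥0∞)
    (y : EuclideanSpace ℝ (Fin n)) :
    lpN (ENNReal.ofReal P) (fun x => F (x + y)) = lpN (ENNReal.ofReal P) F := by
  simp only [lpN, ENNReal.ofReal_ne_top, if_false]
  rw [lintegral_add_right_eq_self fun x => F x ^ (ENNReal.ofReal P).toReal]

lemma jp_le_jp {n : ℕ} {s σ : ℝ} (h : s ≤ σ) (y : EuclideanSpace ℝ (Fin n)) : jp s y ≤ jp σ y :=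
  Real.rpow_le_rpow_of_exponent_le (by nlinarith [sq_nonneg ‖y‖]) (by linarith)

/-- A form of Peetre's inequality. -/
lemma jp_le_mul_jp {n : ℕ} {σ : ℝ} (hσ : 0 ≤ σ) (x ξ : EuclideanSpace ℝ (Fin n)) :
    jp σ ξ ≤ 2 ^ (σ / 2) * (jp σ x * jp σ (ξ + (1 / 2 : ℝ) • x)) := by
  unfold jp
  rw [← Real.mul_rpow (by positivity) (by positivity),
    ← Real.mul_rpow (by norm_num) (by positivity)]
  refine Real.rpow_le_rpow (by positivity) ?_ (by positivity)
  set u := ξ + (1 / 2 : ℝ) • x with hu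
  have hξ : ξ = u - (1 / 2 : ℝ) • x := by rw [hu, add_sub_cancel_right]
  have h : ‖ξ‖ ≤ ‖u‖ + 1 / 2 * ‖x‖ := by
    rw [hξ]
    refine (norm_sub_le _ _).trans_eq ?_
    rw [norm_smul, Real.norm_eq_abs, abs_of_pos (by norm_num)]
  nlinarith [norm_nonneg ξ, norm_nonneg x, norm_nonneg u, sq_nonneg (‖u‖ - 1 / 2 * ‖x‖),
    mul_nonneg (sq_nonneg ‖u‖) (sq_nonneg ‖x‖), sq_nonneg ‖x‖, sq_nonneg ‖u‖,
    pow_le_pow_left₀ (norm_nonneg ξ) h 2]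

lemma exists_jp_mul_exp_neg_le {n : ℕ} {σ : ℝ} (hσ : 0 ≤ σ) :
    ∃ M : ℝ, 0 < M ∧ ∀ u : EuclideanSpace ℝ (Fin n),
      jp σ u * Real.exp (-(1 / 16 * ‖u‖ ^ 2)) ≤ M * Real.exp (-(1 / 32 * ‖u‖ ^ 2)) := by
  obtain ⟨M, hM0, hM⟩ := exists_one_add_rpow_mul_exp_neg_le (σ / 2) (c := 1 / 32)
    (by positivity) (by norm_num)
  refine ⟨M, hM0, fun u => ?_⟩
  rw [show -(1 / 16 * ‖u‖ ^ 2) = -(1 / 32 * ‖u‖ ^ 2) + -(1 / 32 * ‖u‖ ^ 2) by ring, Real.exp_add,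
    ← mul_assoc]
  gcongr
  exact hM _ (sq_nonneg _)

/-- Upper bound for the weighted norm of superpositions of chirped Gaussians of dyadically
shrinking widths, inner exponent larger than outer exponent. -/
lemma exists_WNorm_le_of_lt {n : ℕ} (hn : 1 ≤ n) {P s K : ℝ} (hP : 1 ≤ P) (hK : 0 ≤ K)
    {Q : ℝ≥0∞} (hPQ : ENNReal.ofReal P < Q) (hs : s ≤ n * (P⁻¹ - Q⁻¹.toReal)) :
    ∃ M : ℝ≥0∞, M ≠ ∞ ∧ ∀ (J : ℕ) (d : ℕ → ℂ) (f : EuclideanSpace ℝ (Fin n) → ℂ),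
      (∀ j, ‖d j‖ ≤ K * dyadicCoeff n P j * (4 ^ j : ℝ) ^ (n / 2 : ℝ)) →
      (∀ x ξ, STFT gauss f x ξ =
        ∑ j ∈ Finset.range J, d j * gaussSTFT (((4 ^ j : ℝ) : ℂ) + Complex.I / 4) x ξ) →
      WNorm s (ENNReal.ofReal P) Q f ≤ M := by
  have hP0 : 0 < P := by linarith
  have hPne : ENNReal.ofReal P ≠ 0 := by simpa using hP0
  obtain ⟨M, hM, hbound⟩ := exists_lpN_jp_mul_dyadicSum_le hn hP (c := 1 / 16) (by norm_num) hPQ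
  set L := lpN (ENNReal.ofReal P) (fun x : EuclideanSpace ℝ (Fin n) =>
      ENNReal.ofReal (Real.exp (-(1 / 4 * ‖x‖ ^ 2)))) with hL
  have hLtop : L ≠ ∞ := lpN_exp_neg_mul_sq_norm_ne_top hP0 (by norm_num)
  refine ⟨ENNReal.ofReal (K * π ^ (n / 2 : ℝ)) * M * L,
    ENNReal.mul_ne_top (ENNReal.mul_ne_top ENNReal.ofReal_ne_top hM) hLtop, ?_⟩
  intro J d f hd hf
  have hpt : ∀ x ξ, ‖STFT gauss f x ξ‖ ≤ K * π ^ (n / 2 : ℝ) *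
      (Real.exp (-(1 / 4 * ‖x‖ ^ 2)) * dyadicSum P (1 / 16) J ξ) := by
    intro x ξ
    rw [hf, dyadicSum, Finset.mul_sum, Finset.mul_sum]
    refine (norm_sum_le _ _).trans (Finset.sum_le_sum fun j _ => ?_)
    rw [norm_mul]
    refine (mul_le_mul (hd j) (norm_gaussSTFT_le_of_one_le (one_le_pow₀ (by norm_num)) x ξ)
      (norm_nonneg _) ((norm_nonneg _).trans (hd j))).trans_eq ?_
    have h4 : (4 ^ j : ℝ) ^ (n / 2 : ℝ) ≠ 0 := by positivity
    rw [Real.div_rpow (by positivity) (by positivity)]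
    field_simp
  have hin : ∀ x, lpN Q (fun ξ => ENNReal.ofReal (jp s ξ) * (‖STFT gauss f x ξ‖₊ : ℝ≥0∞)) ≤
      ENNReal.ofReal (K * π ^ (n / 2 : ℝ)) * M *
        ENNReal.ofReal (Real.exp (-(1 / 4 * ‖x‖ ^ 2))) := by
    intro x
    calc _ ≤ lpN Q (fun ξ => ENNReal.ofReal (K * π ^ (n / 2 : ℝ) *
          Real.exp (-(1 / 4 * ‖x‖ ^ 2))) *
            ENNReal.ofReal (jp (n * (P⁻¹ - Q⁻¹.toReal)) ξ * dyadicSum P (1 / 16) J ξ)) := by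
          refine lpN_mono _ fun ξ => ?_
          rw [← enorm_eq_nnnorm, ← ofReal_norm, ← ENNReal.ofReal_mul (jp_pos _ _).le,
            ← ENNReal.ofReal_mul (by positivity)]
          refine ENNReal.ofReal_le_ofReal ((mul_le_mul (jp_le_jp hs ξ) (hpt x ξ) (norm_nonneg _)
            (jp_pos _ _).le).trans_eq ?_)
          ring
      _ ≤ ENNReal.ofReal (K * π ^ (n / 2 : ℝ) * Real.exp (-(1 / 4 * ‖x‖ ^ 2))) * M := by
          rw [lpN_const_mul (bot_le.trans_lt hPQ).ne' ENNReal.ofReal_ne_top]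
          gcongr
          exact hbound J
      _ = _ := by
          rw [ENNReal.ofReal_mul (by positivity)]
          ring
  refine (lpN_mono _ hin).trans_eq ?_
  rw [lpN_const_mul hPne (ENNReal.mul_ne_top ENNReal.ofReal_ne_top hM)]

/-- Upper bound for the weighted norm of superpositions of chirped Gaussians of dyadically
growing widths, inner exponent smaller than outer exponent. -/
lemma exists_WNorm_le_of_gt {n : ℕ} (hn : 1 ≤ n) {P s K : ℝ} (hP : 1 ≤ P) (hK : 0 ≤ K)
    {Q : ℝ≥0∞} (hPQ : ENNReal.ofReal P < Q) (hi : Q⁻¹.toReal ≤ P⁻¹)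
    (hs : s ≤ n * (P⁻¹ - Q⁻¹.toReal)) :
    ∃ M : ℝ≥0∞, M ≠ ∞ ∧ ∀ (J : ℕ) (d : ℕ → ℂ) (f : EuclideanSpace ℝ (Fin n) → ℂ),
      (∀ j, ‖d j‖ ≤ K * dyadicCoeff n P j) →
      (∀ x ξ, STFT gauss f x ξ =
        ∑ j ∈ Finset.range J, d j * gaussSTFT (((1 / 16 / 4 ^ j : ℝ) : ℂ) + Complex.I / 4) x ξ) →
      WNorm s Q (ENNReal.ofReal P) f ≤ M := by
  have hP0 : 0 < P := by linarith
  have hPne : ENNReal.ofReal P ≠ 0 := by simpa using hP0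
  obtain ⟨M, hM, hbound⟩ := exists_lpN_jp_mul_dyadicSum_le hn hP (c := 1 / 64) (by norm_num) hPQ
  set σ := n * (P⁻¹ - Q⁻¹.toReal) with hσ
  have hσ0 : 0 ≤ σ := mul_nonneg (Nat.cast_nonneg _) (sub_nonneg.2 hi)
  obtain ⟨N, hN0, hN⟩ := exists_jp_mul_exp_neg_le (n := n) hσ0
  set L := lpN (ENNReal.ofReal P) (fun x : EuclideanSpace ℝ (Fin n) =>
      ENNReal.ofReal (Real.exp (-(1 / 32 * ‖x‖ ^ 2)))) with hL
  have hLtop : L ≠ ∞ := lpN_exp_neg_mul_sq_norm_ne_top hP0 (by norm_num)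
  set C := 2 ^ (σ / 2) * K * π ^ (n / 2 : ℝ) * N with hC
  have hC0 : 0 ≤ C := by positivity
  refine ⟨ENNReal.ofReal C * L * M,
    ENNReal.mul_ne_top (ENNReal.mul_ne_top ENNReal.ofReal_ne_top hLtop) hM, ?_⟩
  intro J d f hd hf
  have hpt : ∀ x ξ, ‖STFT gauss f x ξ‖ ≤ K * π ^ (n / 2 : ℝ) *
      (Real.exp (-(1 / 16 * ‖ξ + (1 / 2 : ℝ) • x‖ ^ 2)) * dyadicSum P (1 / 64) J x) := by
    intro x ξ
    rw [hf, dyadicSum, Finset.mul_sum, Finset.mul_sum]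
    refine (norm_sum_le _ _).trans (Finset.sum_le_sum fun j _ => ?_)
    rw [norm_mul]
    have ha : (1 / 16 / 4 ^ j : ℝ) ≤ 1 / 16 :=
      div_le_self (by norm_num) (one_le_pow₀ (by norm_num))
    refine (mul_le_mul (hd j) (norm_gaussSTFT_le_of_le (by positivity) ha x ξ)
      (norm_nonneg _) ((norm_nonneg _).trans (hd j))).trans_eq ?_
    rw [show (1 / 16 / 4 ^ j / 4 : ℝ) = 1 / 64 / 4 ^ j by ring]
    ring
  have hin : ∀ x, lpN (ENNReal.ofReal P)
      (fun ξ => ENNReal.ofReal (jp s ξ) * (‖STFT gauss f x ξ‖₊ : ℝ≥0∞)) ≤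
      ENNReal.ofReal C * L * ENNReal.ofReal (jp σ x * dyadicSum P (1 / 64) J x) := by
    intro x
    have hS := dyadicSum_nonneg P (1 / 64) J x
    have hj := (jp_pos σ x).le
    calc _ ≤ lpN (ENNReal.ofReal P) (fun ξ => ENNReal.ofReal (C *
          (jp σ x * dyadicSum P (1 / 64) J x)) *
            ENNReal.ofReal (Real.exp (-(1 / 32 * ‖ξ + (1 / 2 : ℝ) • x‖ ^ 2)))) := by
          refine lpN_mono _ fun ξ => ?_
          rw [← enorm_eq_nnnorm, ← ofReal_norm, ← ENNReal.ofReal_mul (jp_pos _ _).le,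
            ← ENNReal.ofReal_mul (by positivity)]
          refine ENNReal.ofReal_le_ofReal ?_
          calc jp s ξ * ‖STFT gauss f x ξ‖
              ≤ 2 ^ (σ / 2) * (jp σ x * jp σ (ξ + (1 / 2 : ℝ) • x)) * (K * π ^ (n / 2 : ℝ) *
                (Real.exp (-(1 / 16 * ‖ξ + (1 / 2 : ℝ) • x‖ ^ 2)) * dyadicSum P (1 / 64) J x)) :=
                mul_le_mul ((jp_le_jp hs ξ).trans (jp_le_mul_jp hσ0 x ξ)) (hpt x ξ)
                  (norm_nonneg _) ((jp_pos _ _).le.trans (jp_le_mul_jp hσ0 x ξ))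
            _ = 2 ^ (σ / 2) * K * π ^ (n / 2 : ℝ) * (jp σ x * dyadicSum P (1 / 64) J x) *
                (jp σ (ξ + (1 / 2 : ℝ) • x) *
                  Real.exp (-(1 / 16 * ‖ξ + (1 / 2 : ℝ) • x‖ ^ 2))) := by ring
            _ ≤ 2 ^ (σ / 2) * K * π ^ (n / 2 : ℝ) * (jp σ x * dyadicSum P (1 / 64) J x) *
                (N * Real.exp (-(1 / 32 * ‖ξ + (1 / 2 : ℝ) • x‖ ^ 2))) := by
                exact mul_le_mul_of_nonneg_left (hN _) (by positivity)
            _ = _ := by rw [hC]; ring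
      _ = ENNReal.ofReal (C * (jp σ x * dyadicSum P (1 / 64) J x)) * L := by
          rw [lpN_const_mul hPne ENNReal.ofReal_ne_top, lpN_ofReal_comp_add P
            fun ξ => ENNReal.ofReal (Real.exp (-(1 / 32 * ‖ξ‖ ^ 2)))]
      _ = _ := by
          rw [ENNReal.ofReal_mul hC0]
          ring
  refine (lpN_mono _ hin).trans ?_
  rw [lpN_const_mul (bot_le.trans_lt hPQ).ne' (ENNReal.mul_ne_top ENNReal.ofReal_ne_top hLtop)]
  gcongr
  exact hbound J

/-- The constant produced by integrating the short-time Fourier transform of a complex Gaussian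
against another complex Gaussian. -/
def pairCoeff (n : ℕ) (w b : ℂ) : ℂ :=
  (π / w) ^ ((n / 2 : ℝ) : ℂ) * (π / b) ^ ((n / 2 : ℝ) : ℂ)

lemma norm_pairCoeff (n : ℕ) (w b : ℂ) :
    ‖pairCoeff n w b‖ = (π ^ 2 / ‖w * b‖) ^ (n / 2 : ℝ) := by
  rw [pairCoeff, norm_mul, Complex.norm_cpow_real, Complex.norm_cpow_real,
    ← Real.mul_rpow (norm_nonneg _) (norm_nonneg _), ← norm_mul, div_mul_div_comm, norm_div,
    norm_mul, Complex.norm_real, Real.norm_eq_abs, abs_of_pos Real.pi_pos, pow_two]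

/-- The Gaussian used to test the short-time Fourier transform in the frequency variable. -/
def freqWeight {n : ℕ} (ν : ℂ) (x ξ : EuclideanSpace ℝ (Fin n)) : ℂ :=
  Complex.exp (-ν * Complex.ofReal (‖ξ‖ ^ 2) + (ν + Complex.I) * Complex.ofReal ⟪x, ξ⟫ -
    ν / 4 * Complex.ofReal (‖x‖ ^ 2))

lemma gaussSTFT_mul_freqWeight {n : ℕ} (z ν : ℂ) (x ξ : EuclideanSpace ℝ (Fin n)) :
    gaussSTFT z x ξ * freqWeight ν x ξ = (π / (1 + z)) ^ ((n / 2 : ℝ) : ℂ) *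
      Complex.exp ((-1 + 1 / (1 + z) - ν / 4) * Complex.ofReal (‖x‖ ^ 2)) *
      quadExp (1 / (1 + z) / 4 + ν) (ν + Complex.I * (1 - 1 / (1 + z))) 0 x 0 ξ := by
  unfold gaussSTFT freqWeight quadExp
  generalize ((π : ℂ) / (1 + z)) ^ ((n / 2 : ℝ) : ℂ) = k
  rw [mul_assoc k, mul_assoc k, ← Complex.exp_add, ← Complex.exp_add, div_mul_eq_div_div_swap,
    div_eq_mul_one_div _ (1 + z)]
  congr 2
  ring

lemma integral_gaussSTFT_mul_freqWeight {n : ℕ} {z ν : ℂ}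
    (hb : 0 < (1 / (1 + z) / 4 + ν).re) (x : EuclideanSpace ℝ (Fin n)) :
    ∫ ξ, gaussSTFT z x ξ * freqWeight ν x ξ =
      pairCoeff n (1 + z) (1 / (1 + z) / 4 + ν) *
        Complex.exp ((-1 + 1 / (1 + z) - ν / 4 + (ν + Complex.I * (1 - 1 / (1 + z))) ^ 2 /
          (4 * (1 / (1 + z) / 4 + ν))) * Complex.ofReal (‖x‖ ^ 2)) := by
  simp_rw [gaussSTFT_mul_freqWeight]
  rw [integral_const_mul, integral_quadExp hb, pairCoeff, mul_mul_mul_comm, ← Complex.exp_add]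
  congr 2
  simp only [inner_zero_right, norm_zero]
  ring

lemma gaussSTFT_mul_cgauss {n : ℕ} (z μ : ℂ) (x ξ : EuclideanSpace ℝ (Fin n)) :
    gaussSTFT z x ξ * cgauss μ x = (π / (1 + z)) ^ ((n / 2 : ℝ) : ℂ) *
      Complex.exp (-(1 / (1 + z)) / 4 * Complex.ofReal (‖ξ‖ ^ 2)) *
      quadExp (1 + μ - 1 / (1 + z)) 0 (-Complex.I * (1 / (1 + z))) 0 ξ x := by
  unfold gaussSTFT cgauss quadExp
  generalize ((π : ℂ) / (1 + z)) ^ ((n / 2 : ℝ) : ℂ) = k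
  rw [mul_assoc k, mul_assoc k, ← Complex.exp_add, ← Complex.exp_add, div_mul_eq_div_div_swap,
    div_eq_mul_one_div _ (1 + z), real_inner_comm ξ x]
  congr 2
  ring

lemma integral_gaussSTFT_mul_cgauss {n : ℕ} {z μ : ℂ}
    (hb : 0 < (1 + μ - 1 / (1 + z)).re) (ξ : EuclideanSpace ℝ (Fin n)) :
    ∫ x, gaussSTFT z x ξ * cgauss μ x =
      pairCoeff n (1 + z) (1 + μ - 1 / (1 + z)) *
        Complex.exp ((-(1 / (1 + z)) / 4 + (-Complex.I * (1 / (1 + z))) ^ 2 /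
          (4 * (1 + μ - 1 / (1 + z)))) * Complex.ofReal (‖ξ‖ ^ 2)) := by
  simp_rw [gaussSTFT_mul_cgauss]
  rw [integral_const_mul, integral_quadExp hb, pairCoeff, mul_mul_mul_comm, ← Complex.exp_add]
  congr 2
  simp only [inner_zero_left, norm_zero]
  ring

lemma continuous_gaussSTFT {n : ℕ} (z : ℂ) :
    Continuous fun y : EuclideanSpace ℝ (Fin n) × EuclideanSpace ℝ (Fin n) =>
      gaussSTFT z y.1 y.2 := by
  unfold gaussSTFT
  fun_prop

lemma freq_width_mul {κ : ℝ} (hκ : 0 < κ) :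
    (1 + (κ - Complex.I / 4)) * (1 / (1 + (κ - Complex.I / 4)) / 4 + 1 / (4 + Complex.I)) =
      (2 + κ) / (4 + Complex.I) := by
  have hw : (1 + (κ - Complex.I / 4) : ℂ) ≠ 0 := fun h => by
    have := congrArg Complex.re h
    simp at this
    linarith
  have hc : (4 + Complex.I : ℂ) ≠ 0 := fun h => by simpa using congrArg Complex.im h
  generalize hc' : (4 + Complex.I : ℂ) = c at hc
  generalize hw' : (1 + (κ - Complex.I / 4) : ℂ) = w at hw
  field_simp
  rw [← hc', ← hw']
  ring

lemma freq_exponent_eq {κ : ℝ} (hκ : 0 < κ) :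
    -1 + 1 / (1 + (κ - Complex.I / 4)) - 1 / (4 + Complex.I) / 4 + (1 / (4 + Complex.I) +
      Complex.I * (1 - 1 / (1 + (κ - Complex.I / 4)))) ^ 2 /
        (4 * (1 / (1 + (κ - Complex.I / 4)) / 4 + 1 / (4 + Complex.I))) =
      -(2 * κ / (2 + κ) : ℝ) + Complex.I / 4 := by
  have hw : (1 + (κ - Complex.I / 4) : ℂ) ≠ 0 := fun h => by
    have := congrArg Complex.re h
    simp at this
    linarith
  have hc : (4 + Complex.I : ℂ) ≠ 0 := fun h => by simpa using congrArg Complex.im h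
  have h2 : (2 + κ : ℂ) ≠ 0 := by exact_mod_cast (by linarith : (2 + κ : ℝ) ≠ 0)
  have hb : 1 / (1 + (κ - Complex.I / 4)) / 4 + 1 / (4 + Complex.I) =
      (2 + κ) / ((4 + Complex.I) * (1 + (κ - Complex.I / 4))) := by
    rw [← div_div, ← freq_width_mul hκ, mul_div_cancel_left₀ _ hw]
  rw [hb]
  push_cast
  have hI := Complex.I_sq
  generalize hc' : (4 + Complex.I : ℂ) = c at *
  generalize hw' : (1 + (κ - Complex.I / 4) : ℂ) = w at *
  generalize hk' : (2 + κ : ℂ) = k at *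
  field_simp
  obtain rfl : k = w + 1 + Complex.I / 4 := by rw [← hk', ← hw']; ring
  obtain h : (κ : ℂ) = w - 1 + Complex.I / 4 := by rw [← hw']; ring
  rw [h, ← hc']
  generalize Complex.I = i at *
  grind

/-- Lebesgue measure weighted by the Gaussian of parameter `c` centred at `v`. -/
def gaussMeasure {n : ℕ} (c : ℝ) (v : EuclideanSpace ℝ (Fin n)) :
    Measure (EuclideanSpace ℝ (Fin n)) :=
  volume.withDensity fun y => ENNReal.ofReal (Real.exp (-(c * ‖y - v‖ ^ 2)))

instance {n : ℕ} (c : ℝ) (v : EuclideanSpace ℝ (Fin n)) : SFinite (gaussMeasure c v) := by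
  unfold gaussMeasure; infer_instance

lemma gaussMeasure_univ {n : ℕ} {c : ℝ} (hc : 0 < c) (v : EuclideanSpace ℝ (Fin n)) :
    gaussMeasure c v Set.univ = ENNReal.ofReal ((π / c) ^ (n / 2 : ℝ)) := by
  rw [gaussMeasure, withDensity_apply _ MeasurableSet.univ, Measure.restrict_univ,
    lintegral_sub_right_eq_self (fun y => ENNReal.ofReal (Real.exp (-(c * ‖y‖ ^ 2)))) v,
    lintegral_exp_neg_mul_sq_norm hc]

lemma lintegral_gaussMeasure {n : ℕ} (c : ℝ) (v : EuclideanSpace ℝ (Fin n))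
    {F : EuclideanSpace ℝ (Fin n) → ℝ≥0∞} (hF : Measurable F) :
    ∫⁻ y, F y ∂(gaussMeasure c v) =
      ∫⁻ y, ENNReal.ofReal (Real.exp (-(c * ‖y - v‖ ^ 2))) * F y := by
  rw [gaussMeasure, lintegral_withDensity_eq_lintegral_mul _ (by fun_prop) hF]
  rfl

lemma gaussMeasure_le {n : ℕ} {c : ℝ} (hc : 0 < c) (v : EuclideanSpace ℝ (Fin n)) :
    gaussMeasure c v ≤ volume := by
  refine (withDensity_mono (.of_forall fun y => ?_)).trans_eq withDensity_one
  simp only [Pi.one_apply]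
  rw [← ENNReal.ofReal_one]
  exact ENNReal.ofReal_le_ofReal (Real.exp_le_one_iff.2 (by simp; positivity))

/-- Lowering the exponent on a Gaussian-weighted space. -/
lemma exists_eLpNorm_gaussMeasure_le (n : ℕ) {c : ℝ} (hc : 0 < c) {r p : ℝ≥0∞} (hr : 1 ≤ r)
    (hrp : r ≤ p) : ∃ K : ℝ≥0∞, K ≠ ∞ ∧ ∀ (v : EuclideanSpace ℝ (Fin n))
      (F : EuclideanSpace ℝ (Fin n) → ℝ≥0∞), Measurable F →
        eLpNorm F r (gaussMeasure c v) ≤ K * lpN p F := by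
  have hp0 : p ≠ 0 := (zero_lt_one.trans_le (hr.trans hrp)).ne'
  have hr0 : r ≠ 0 := (zero_lt_one.trans_le hr).ne'
  refine ⟨ENNReal.ofReal ((π / c) ^ (n / 2 : ℝ)) ^ (1 / r.toReal - 1 / p.toReal), ?_,
    fun v F hF => ?_⟩
  · refine ENNReal.rpow_ne_top_of_ne_zero ?_ ENNReal.ofReal_ne_top
    exact (ENNReal.ofReal_pos.2 (by positivity)).ne'
  · rw [lpN_eq_eLpNorm hp0, mul_comm, ← gaussMeasure_univ hc v]
    refine (eLpNorm_le_eLpNorm_mul_rpow_measure_univ hrp hF.aestronglyMeasurable).trans ?_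
    gcongr
    exact (gaussMeasure_le hc v)

lemma re_one_div_four_add_I : (1 / (4 + Complex.I)).re = 4 / 17 := by
  rw [one_div, Complex.inv_re, Complex.normSq_apply]
  norm_num

lemma norm_freqWeight {n : ℕ} (x ξ : EuclideanSpace ℝ (Fin n)) :
    ‖freqWeight (1 / (4 + Complex.I)) x ξ‖ =
      Real.exp (-(4 / 17 * ‖ξ - (1 / 2 : ℝ) • x‖ ^ 2)) := by
  rw [freqWeight, Complex.norm_exp, norm_sub_sq_real, inner_smul_right, norm_smul, mul_pow,
    real_inner_comm x ξ, Real.norm_eq_abs, abs_of_pos (by norm_num)]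
  congr 1
  rw [Complex.sub_re, Complex.add_re, Complex.re_mul_ofReal, Complex.re_mul_ofReal,
    Complex.re_mul_ofReal, Complex.neg_re, Complex.add_re, Complex.div_ofNat_re,
    re_one_div_four_add_I, Complex.I_re]
  ring

/-- Testing in the frequency variable recovers the dyadic sums from the evolved superposition. -/
lemma dyadicSum_le_lintegral_freq {n : ℕ} (P : ℝ) (J : ℕ) {e : ℕ → ℂ}
    (he : ∀ j, e j * pairCoeff n (1 + (((1 / (16 * 4 ^ j) : ℝ) : ℂ) - Complex.I / 4))
      (1 / (1 + (((1 / (16 * 4 ^ j) : ℝ) : ℂ) - Complex.I / 4)) / 4 + 1 / (4 + Complex.I)) =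
        dyadicCoeff n P j) (x : EuclideanSpace ℝ (Fin n)) :
    ENNReal.ofReal (dyadicSum P (1 / 16) J x) ≤
      ∫⁻ ξ, ‖∑ j ∈ Finset.range J, e j *
        gaussSTFT (((1 / (16 * 4 ^ j) : ℝ) : ℂ) - Complex.I / 4) x ξ‖ₑ
          ∂(gaussMeasure (4 / 17) ((1 / 2 : ℝ) • x)) := by
  have hκ : ∀ j : ℕ, (0 : ℝ) < 1 / (16 * 4 ^ j) := fun j => by positivity
  generalize hk : (fun j : ℕ => (1 / (16 * 4 ^ j) : ℝ)) = κ at *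
  have hkj : ∀ j : ℕ, (1 / (16 * 4 ^ j) : ℝ) = κ j := fun j => congrFun hk j
  simp_rw [hkj] at he hκ ⊢
  have hb : ∀ j, 0 < (1 / (1 + ((κ j : ℂ) - Complex.I / 4)) / 4 + 1 / (4 + Complex.I)).re := by
    intro j
    rw [Complex.add_re, re_one_div_four_add_I, Complex.div_ofNat_re]
    have := re_one_div_pos (z := 1 + ((κ j : ℂ) - Complex.I / 4)) (by simp; linarith [hκ j])
    linarith
  have hsum : ∫ ξ, (∑ j ∈ Finset.range J, e j * gaussSTFT ((κ j : ℂ) - Complex.I / 4) x ξ) *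
      freqWeight (1 / (4 + Complex.I)) x ξ =
        Complex.exp (Complex.I / 4 * Complex.ofReal (‖x‖ ^ 2)) *
          ((∑ j ∈ Finset.range J, dyadicCoeff n P j *
            Real.exp (-(2 * κ j / (2 + κ j)) * ‖x‖ ^ 2) : ℝ) : ℂ) := by
    simp_rw [Finset.sum_mul, mul_assoc]
    rw [integral_finsetSum, Complex.ofReal_sum, Finset.mul_sum]
    · refine Finset.sum_congr rfl fun j _ => ?_
      rw [integral_const_mul, integral_gaussSTFT_mul_freqWeight (hb j), ← mul_assoc, he,
        freq_exponent_eq (hκ j), Complex.ofReal_mul, Complex.ofReal_exp, mul_left_comm,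
        ← Complex.exp_add]
      congr 2
      push_cast
      ring
    · intro j _
      simp_rw [gaussSTFT_mul_freqWeight]
      exact ((integrable_quadExp (hb j) _ _ _ _).const_mul _).const_mul _
  have hle : dyadicSum P (1 / 16) J x ≤ ∑ j ∈ Finset.range J, dyadicCoeff n P j *
      Real.exp (-(2 * κ j / (2 + κ j)) * ‖x‖ ^ 2) := by
    refine Finset.sum_le_sum fun j _ => ?_
    refine mul_le_mul_of_nonneg_left (Real.exp_le_exp.2 ?_) (dyadicCoeff_pos n P j).le
    rw [neg_mul, neg_le_neg_iff, show (1 / 16 / 4 ^ j : ℝ) = κ j by rw [← hkj]; ring]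
    gcongr
    have := hκ j
    rw [div_le_iff₀ (by positivity)]
    nlinarith
  have hmeas : Measurable fun ξ => ‖∑ j ∈ Finset.range J, e j *
      gaussSTFT ((κ j : ℂ) - Complex.I / 4) x ξ‖ₑ :=
    (continuous_finsetSum _ fun j _ => continuous_const.mul
      ((continuous_gaussSTFT _).comp (Continuous.prodMk_right x))).enorm.measurable
  rw [lintegral_gaussMeasure _ _ hmeas]
  calc ENNReal.ofReal (dyadicSum P (1 / 16) J x)
      ≤ ‖∫ ξ, (∑ j ∈ Finset.range J, e j * gaussSTFT ((κ j : ℂ) - Complex.I / 4) x ξ) *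
          freqWeight (1 / (4 + Complex.I)) x ξ‖ₑ := by
        rw [hsum, ← ofReal_norm, norm_mul, Complex.norm_exp, Complex.re_mul_ofReal,
          Complex.norm_real]
        refine ENNReal.ofReal_le_ofReal (hle.trans ?_)
        simpa using le_abs_self _
    _ ≤ _ := by
        refine (enorm_integral_le_lintegral_enorm _).trans_eq (lintegral_congr fun ξ => ?_)
        rw [enorm_mul, mul_comm, ← norm_freqWeight, ofReal_norm]

lemma one_add_sub_I_ne_zero {A : ℝ} (hA : 0 < A) : (1 + (A - Complex.I / 4) : ℂ) ≠ 0 := fun h => by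
  have := congrArg Complex.re h
  simp at this
  linarith

lemma space_width_mul {A : ℝ} (hA : 0 < A) :
    (1 + (A - Complex.I / 4)) * (1 + (3 + 4 * Complex.I) / 5 - 1 / (1 + (A - Complex.I / 4))) =
      (8 + 4 * Complex.I) / 5 * (A + 1 / 2) := by
  have hw := one_add_sub_I_ne_zero hA
  rw [mul_sub, mul_one_div_cancel hw]
  linear_combination (-1 / 5 : ℂ) * Complex.I_sq

lemma re_space_width_pos {A : ℝ} (hA : 0 < A) :
    0 < (1 + (3 + 4 * Complex.I) / 5 - 1 / (1 + (A - Complex.I / 4))).re := by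
  have h1 : (1 : ℝ) ≤ ‖(1 + (A - Complex.I / 4) : ℂ)‖ := by
    refine le_trans ?_ (Complex.re_le_norm _)
    simpa using hA.le
  have h2 : (1 / (1 + (A - Complex.I / 4)) : ℂ).re ≤ 1 := by
    refine (Complex.re_le_norm _).trans ?_
    rw [norm_div, norm_one]
    exact div_le_one_of_le₀ h1 (norm_nonneg _)
  rw [Complex.sub_re]
  have h3 : (1 + (3 + 4 * Complex.I) / 5 : ℂ).re = 8 / 5 := by
    simp
    norm_num
  linarith

lemma space_exponent_eq {A : ℝ} (hA : 0 < A) :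
    -(1 / (1 + (A - Complex.I / 4))) / 4 + (-Complex.I * (1 / (1 + (A - Complex.I / 4)))) ^ 2 /
      (4 * (1 + (3 + 4 * Complex.I) / 5 - 1 / (1 + (A - Complex.I / 4)))) =
        -((4 * (A + 1 / 2))⁻¹ : ℝ) := by
  have hw := one_add_sub_I_ne_zero hA
  have hb : (1 + (3 + 4 * Complex.I) / 5 - 1 / (1 + (A - Complex.I / 4))) =
      (8 + 4 * Complex.I) / 5 * (A + 1 / 2) / (1 + (A - Complex.I / 4)) := by
    rw [← space_width_mul hA, mul_div_cancel_left₀ _ hw]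
  have h8 : (8 + 4 * Complex.I : ℂ) ≠ 0 := fun h => by simpa using congrArg Complex.im h
  have hA2 : (A + 1 / 2 : ℂ) ≠ 0 := by
    have := Complex.ofReal_ne_zero.2 (by positivity : (A + 1 / 2 : ℝ) ≠ 0)
    push_cast at this
    exact this
  rw [hb]
  push_cast
  have hI := Complex.I_sq
  have h3 : (1 + (A - Complex.I / 4) : ℂ) = (A + 1 / 2 : ℂ) + 1 / 2 - Complex.I / 4 := by ring
  rw [h3] at hw ⊢
  generalize (A + 1 / 2 : ℂ) = B at *
  generalize hc' : (8 + 4 * Complex.I : ℂ) = c at *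
  generalize hw' : B + 1 / 2 - Complex.I / 4 = w at *
  rw [neg_mul, neg_sq, mul_pow, hI]
  field_simp
  rw [← hc', ← hw']
  generalize Complex.I = i at *
  grind

lemma norm_cgauss_space {n : ℕ} (x : EuclideanSpace ℝ (Fin n)) :
    ‖cgauss ((3 + 4 * Complex.I) / 5) x‖ = Real.exp (-(3 / 5 * ‖x - 0‖ ^ 2)) := by
  rw [cgauss, Complex.norm_exp, Complex.re_mul_ofReal, sub_zero]
  congr 1
  simp

/-- Testing in the space variable recovers the dyadic sums from the evolved superposition. -/
lemma dyadicSum_le_lintegral_space {n : ℕ} (P : ℝ) (J : ℕ) {e : ℕ → ℂ}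
    (he : ∀ j, e j * pairCoeff n (1 + (((4 ^ j : ℝ) : ℂ) - Complex.I / 4))
      (1 + (3 + 4 * Complex.I) / 5 - 1 / (1 + (((4 ^ j : ℝ) : ℂ) - Complex.I / 4))) =
        dyadicCoeff n P j) (ξ : EuclideanSpace ℝ (Fin n)) :
    ENNReal.ofReal (dyadicSum P 1 J ξ) ≤
      ∫⁻ x, ‖∑ j ∈ Finset.range J, e j *
        gaussSTFT (((4 ^ j : ℝ) : ℂ) - Complex.I / 4) x ξ‖ₑ ∂(gaussMeasure (3 / 5) 0) := by
  have hA : ∀ j : ℕ, (0 : ℝ) < 4 ^ j := fun j => by positivity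
  generalize hk : (fun j : ℕ => (4 ^ j : ℝ)) = A at *
  have hkj : ∀ j : ℕ, (4 ^ j : ℝ) = A j := fun j => congrFun hk j
  simp_rw [hkj] at he hA ⊢
  have hb := fun j => re_space_width_pos (hA j)
  have hsum : ∫ x, (∑ j ∈ Finset.range J, e j * gaussSTFT ((A j : ℂ) - Complex.I / 4) x ξ) *
      cgauss ((3 + 4 * Complex.I) / 5) x =
          ((∑ j ∈ Finset.range J, dyadicCoeff n P j *
            Real.exp (-(4 * (A j + 1 / 2))⁻¹ * ‖ξ‖ ^ 2) : ℝ) : ℂ) := by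
    simp_rw [Finset.sum_mul, mul_assoc]
    rw [integral_finsetSum, Complex.ofReal_sum]
    · refine Finset.sum_congr rfl fun j _ => ?_
      rw [integral_const_mul, integral_gaussSTFT_mul_cgauss (hb j), ← mul_assoc, he,
        space_exponent_eq (hA j), Complex.ofReal_mul, Complex.ofReal_exp]
      push_cast
      rfl
    · intro j _
      simp_rw [gaussSTFT_mul_cgauss]
      exact ((integrable_quadExp (hb j) _ _ _ _).const_mul _).const_mul _
  have hle : dyadicSum P 1 J ξ ≤ ∑ j ∈ Finset.range J, dyadicCoeff n P j *
      Real.exp (-(4 * (A j + 1 / 2))⁻¹ * ‖ξ‖ ^ 2) := by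
    refine Finset.sum_le_sum fun j _ => ?_
    refine mul_le_mul_of_nonneg_left (Real.exp_le_exp.2 ?_) (dyadicCoeff_pos n P j).le
    have := hA j
    rw [neg_mul, neg_le_neg_iff, hkj, one_div (A j)]
    exact mul_le_mul_of_nonneg_right (inv_anti₀ this (by linarith)) (sq_nonneg _)
  have hmeas : Measurable fun x => ‖∑ j ∈ Finset.range J, e j *
      gaussSTFT ((A j : ℂ) - Complex.I / 4) x ξ‖ₑ :=
    (continuous_finsetSum _ fun j _ => continuous_const.mul
      ((continuous_gaussSTFT _).comp (Continuous.prodMk_left ξ))).enorm.measurable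
  rw [lintegral_gaussMeasure _ _ hmeas]
  calc ENNReal.ofReal (dyadicSum P 1 J ξ)
      ≤ ‖∫ x, (∑ j ∈ Finset.range J, e j * gaussSTFT ((A j : ℂ) - Complex.I / 4) x ξ) *
          cgauss ((3 + 4 * Complex.I) / 5) x‖ₑ := by
        rw [hsum, ← ofReal_norm, Complex.norm_real]
        exact ENNReal.ofReal_le_ofReal (hle.trans (le_abs_self _))
    _ ≤ _ := by
        refine (enorm_integral_le_lintegral_enorm _).trans_eq (lintegral_congr fun x => ?_)
        rw [enorm_mul, mul_comm, ← norm_cgauss_space, ofReal_norm]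

lemma WNorm_zero_eq {n : ℕ} (p q : ℝ≥0∞) (f : EuclideanSpace ℝ (Fin n) → ℂ) :
    WNorm 0 p q f = lpN p (fun x => lpN q (fun ξ => ‖STFT gauss f x ξ‖ₑ)) := by
  simp [WNorm, jp, enorm_eq_nnnorm]

/-- Lower bound for the norm of the evolved superposition, inner exponent arbitrary. -/
lemma exists_lpN_dyadicSum_le_freq (n : ℕ) (P : ℝ) {p q : ℝ≥0∞} (hp : 1 ≤ p) (hq : 1 ≤ q) :
    ∃ K : ℝ≥0∞, K ≠ ∞ ∧ ∀ (J : ℕ) (e : ℕ → ℂ) (f : EuclideanSpace ℝ (Fin n) → ℂ),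
      (∀ j, e j * pairCoeff n (1 + (((1 / (16 * 4 ^ j) : ℝ) : ℂ) - Complex.I / 4))
        (1 / (1 + (((1 / (16 * 4 ^ j) : ℝ) : ℂ) - Complex.I / 4)) / 4 + 1 / (4 + Complex.I)) =
          dyadicCoeff n P j) →
      (∀ x ξ, STFT gauss f x ξ = ∑ j ∈ Finset.range J, e j *
        gaussSTFT (((1 / (16 * 4 ^ j) : ℝ) : ℂ) - Complex.I / 4) x ξ) →
      lpN p (fun x : EuclideanSpace ℝ (Fin n) => ENNReal.ofReal (dyadicSum P (1 / 16) J x)) ≤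
        K * WNorm 0 p q f := by
  obtain ⟨K, hK, hKb⟩ := exists_eLpNorm_gaussMeasure_le n (c := 4 / 17) (by norm_num) le_rfl hq
  refine ⟨K, hK, fun J e f he hf => ?_⟩
  rw [WNorm_zero_eq, ← lpN_const_mul (zero_lt_one.trans_le hp).ne' hK]
  refine lpN_mono _ fun x => ?_
  refine (dyadicSum_le_lintegral_freq P J he x).trans ?_
  simp_rw [← hf]
  refine le_trans (le_of_eq ?_) (hKb ((1 / 2 : ℝ) • x) _ ?_)
  · rw [eLpNorm_one_eq_lintegral_enorm]
    simp
  · simp_rw [hf]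
    exact (continuous_finsetSum _ fun j _ => continuous_const.mul
      ((continuous_gaussSTFT _).comp (Continuous.prodMk_right x))).enorm.measurable

/-- Lower bound for the norm of the evolved superposition, outer exponent larger than the inner
one. -/
lemma exists_lpN_dyadicSum_le_space (n : ℕ) {P : ℝ} (hP : 1 ≤ P) {Q : ℝ≥0∞}
    (hPQ : ENNReal.ofReal P ≤ Q) :
    ∃ K : ℝ≥0∞, K ≠ ∞ ∧ ∀ (J : ℕ) (e : ℕ → ℂ) (f : EuclideanSpace ℝ (Fin n) → ℂ),
      (∀ j, e j * pairCoeff n (1 + (((4 ^ j : ℝ) : ℂ) - Complex.I / 4))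
        (1 + (3 + 4 * Complex.I) / 5 - 1 / (1 + (((4 ^ j : ℝ) : ℂ) - Complex.I / 4))) =
          dyadicCoeff n P j) →
      (∀ x ξ, STFT gauss f x ξ = ∑ j ∈ Finset.range J, e j *
        gaussSTFT (((4 ^ j : ℝ) : ℂ) - Complex.I / 4) x ξ) →
      lpN (ENNReal.ofReal P)
        (fun ξ : EuclideanSpace ℝ (Fin n) => ENNReal.ofReal (dyadicSum P 1 J ξ)) ≤
          K * WNorm 0 Q (ENNReal.ofReal P) f := by
  have hP0 : 0 < P := by linarith
  have hP1 : 1 ≤ ENNReal.ofReal P := by simpa using hP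
  have hPne : ENNReal.ofReal P ≠ 0 := by simpa using hP0
  have htr : (ENNReal.ofReal P).toReal = P := ENNReal.toReal_ofReal hP0.le
  obtain ⟨K₁, hK₁, h₁⟩ := exists_eLpNorm_gaussMeasure_le n (c := 3 / 5) (by norm_num) hP1 hPQ
  set μ : Measure (EuclideanSpace ℝ (Fin n)) := gaussMeasure (3 / 5) 0 with hμ
  have hμu : μ Set.univ ≠ ∞ := by
    rw [hμ, gaussMeasure_univ (by norm_num)]
    exact ENNReal.ofReal_ne_top
  have hμu0 : μ Set.univ ≠ 0 := by
    rw [hμ, gaussMeasure_univ (by norm_num)]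
    exact (ENNReal.ofReal_pos.2 (by positivity)).ne'
  set K₂ := μ Set.univ ^ (1 / (1 : ℝ≥0∞).toReal - 1 / (ENNReal.ofReal P).toReal) with hK₂
  have hK₂t : K₂ ≠ ∞ := ENNReal.rpow_ne_top_of_ne_zero hμu0 hμu
  refine ⟨K₂ * K₁, ENNReal.mul_ne_top hK₂t hK₁, fun J e f he hf => ?_⟩
  set V : EuclideanSpace ℝ (Fin n) × EuclideanSpace ℝ (Fin n) → ℝ≥0∞ :=
    fun y => ‖STFT gauss f y.1 y.2‖ₑ with hV
  have hVm : Measurable V := by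
    rw [hV]
    simp_rw [hf]
    exact (continuous_finsetSum _ fun j _ => continuous_const.mul
      (continuous_gaussSTFT _)).enorm.measurable
  have hVP : Measurable fun y => V y ^ P := hVm.pow_const P
  have hpt : ∀ ξ, ENNReal.ofReal (dyadicSum P 1 J ξ) ≤
      K₂ * (∫⁻ x, V (x, ξ) ^ P ∂μ) ^ P⁻¹ := by
    intro ξ
    refine (dyadicSum_le_lintegral_space P J he ξ).trans ?_
    have h := eLpNorm_le_eLpNorm_mul_rpow_measure_univ (μ := μ) (f := fun x => V (x, ξ)) hP1
      (hVm.comp measurable_prodMk_right).aestronglyMeasurable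
    rw [eLpNorm_one_eq_lintegral_enorm,
      eLpNorm_eq_lintegral_rpow_enorm_toReal hPne ENNReal.ofReal_ne_top, mul_comm, htr,
      one_div] at h
    simpa only [enorm_eq_self, hV, hf, hK₂, htr, one_div] using h
  have hN : ∀ x, lpN (ENNReal.ofReal P) (fun ξ => V (x, ξ)) = (∫⁻ ξ, V (x, ξ) ^ P) ^ P⁻¹ :=
    fun x => by rw [lpN, if_neg ENNReal.ofReal_ne_top, htr]
  have hNm : Measurable fun x => lpN (ENNReal.ofReal P) (fun ξ => V (x, ξ)) := by
    simp_rw [hN]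
    exact hVP.lintegral_prod_right'.pow_const _
  calc _ ≤ K₂ * lpN (ENNReal.ofReal P) (fun ξ => (∫⁻ x, V (x, ξ) ^ P ∂μ) ^ P⁻¹) := by
        rw [← lpN_const_mul hPne hK₂t]
        exact lpN_mono _ hpt
    _ = K₂ * eLpNorm (fun x => lpN (ENNReal.ofReal P) (fun ξ => V (x, ξ)))
          (ENNReal.ofReal P) μ := by
        rw [eLpNorm_eq_lintegral_rpow_enorm_toReal hPne ENNReal.ofReal_ne_top, lpN,
          if_neg ENNReal.ofReal_ne_top, htr, one_div]
        simp_rw [hN, enorm_eq_self, ← ENNReal.rpow_mul, inv_mul_cancel₀ hP0.ne', ENNReal.rpow_one]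
        rw [lintegral_lintegral_swap]
        exact (hVP.comp measurable_swap).aemeasurable
    _ ≤ K₂ * (K₁ * lpN Q fun x => lpN (ENNReal.ofReal P) (fun ξ => V (x, ξ))) := by
        gcongr
        exact h₁ 0 _ hNm
    _ = _ := by rw [WNorm_zero_eq, mul_assoc]

/-- The coefficients of the superpositions, normalised so that both the evolution and the testing
integral reduce to the dyadic coefficients, have the size of the dyadic coefficients. -/
lemma norm_normalised_coeff_le {n : ℕ} {a r B : ℝ} (ha : 0 < a) (hr : 0 ≤ r) (w b : ℂ)
    (h : 4 * a * ‖w * b‖ ≤ π ^ 2 * B) :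
    ‖(r : ℂ) / (schrodCoeff n (a + Complex.I / 4) * pairCoeff n w b)‖ ≤ B ^ (n / 2 : ℝ) * r := by
  rw [norm_div, norm_mul, norm_schrodCoeff n ha, norm_pairCoeff, Complex.norm_real,
    Real.norm_eq_abs, abs_of_nonneg hr, div_eq_mul_inv, mul_comm]
  refine mul_le_mul_of_nonneg_right ?_ hr
  rw [Real.rpow_neg (by positivity), mul_inv, inv_inv, ← Real.inv_rpow (by positivity), inv_div,
    ← Real.mul_rpow (by positivity) (by positivity)]
  refine Real.rpow_le_rpow (by positivity) ?_ (by positivity)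
  rw [← mul_div_assoc, div_le_iff₀ (by positivity), mul_comm B]
  exact h

lemma normalised_coeff_mul {n : ℕ} {a r : ℝ} (ha : 0 < a) {w b : ℂ} (h : w * b ≠ 0) :
    (r : ℂ) / (schrodCoeff n (a + Complex.I / 4) * pairCoeff n w b) *
      schrodCoeff n (a + Complex.I / 4) * pairCoeff n w b = r := by
  have h1 : schrodCoeff n (a + Complex.I / 4) ≠ 0 := by
    rw [← norm_ne_zero_iff, norm_schrodCoeff n ha]
    positivity
  have h2 : pairCoeff n w b ≠ 0 := by
    rw [← norm_ne_zero_iff, norm_pairCoeff]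
    have := norm_pos_iff.2 h
    positivity
  rw [mul_assoc, div_mul_cancel₀ _ (mul_ne_zero h1 h2)]

/-- Failure of the estimate when the inner exponent is larger than the outer one. -/
lemma not_bounded_of_outer_lt_inner {n : ℕ} (hn : 1 ≤ n) {P s : ℝ} (hP : 1 ≤ P) {Q C : ℝ≥0∞}
    (hPQ : ENNReal.ofReal P < Q) (hs : s ≤ n * (P⁻¹ - Q⁻¹.toReal)) (hC : C ≠ ∞)
    (hbdd : ∀ f : SchwartzMap (EuclideanSpace ℝ (Fin n)) ℂ,
      WNorm 0 (ENNReal.ofReal P) Q (schrod 1 ⇑f) ≤ C * WNorm s (ENNReal.ofReal P) Q ⇑f) :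
    False := by
  have hP1 : 1 ≤ ENNReal.ofReal P := by simpa using hP
  obtain ⟨M, hM, hup⟩ := exists_WNorm_le_of_lt hn hP (K := 12 ^ (n / 2 : ℝ)) (by positivity) hPQ hs
  obtain ⟨K, hK, hlow⟩ := exists_lpN_dyadicSum_le_freq n P hP1 (hP1.trans hPQ.le)
  obtain ⟨J, hJ⟩ := exists_lt_lpN_dyadicSum n hP (c := 1 / 16) (by norm_num)
    (ENNReal.mul_ne_top hK (ENNReal.mul_ne_top hC hM))
  have ha : ∀ j : ℕ, (0 : ℝ) < 4 ^ j := fun j => by positivity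
  have hκ : ∀ j : ℕ, (0 : ℝ) < 1 / (16 * 4 ^ j) := fun j => by positivity
  set w : ℕ → ℂ := fun j => 1 + (((1 / (16 * 4 ^ j) : ℝ) : ℂ) - Complex.I / 4) with hw
  set b : ℕ → ℂ := fun j => 1 / w j / 4 + 1 / (4 + Complex.I) with hb
  have hc : (4 + Complex.I : ℂ) ≠ 0 := fun h => by simpa using congrArg Complex.im h
  have hwb : ∀ j, w j * b j = ((2 + 1 / (16 * 4 ^ j) : ℝ) : ℂ) / (4 + Complex.I) := fun j => by
    rw [hb, hw]
    simp only
    rw [freq_width_mul (hκ j), Complex.ofReal_add, Complex.ofReal_ofNat]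
  set d : ℕ → ℂ := fun j => (dyadicCoeff n P j : ℂ) /
    (schrodCoeff n (((4 ^ j : ℝ) : ℂ) + Complex.I / 4) * pairCoeff n (w j) (b j)) with hd
  obtain ⟨f, hf, hsf⟩ := exists_schwartz_STFT_eq (n := n) ha d J
  have h1 := hup J d f (fun j => ?_) hf
  · have h2 := hlow J (fun j => d j * schrodCoeff n (((4 ^ j : ℝ) : ℂ) + Complex.I / 4))
      (schrod 1 f) (fun j => ?_) hsf
    · refine hJ.not_ge (h2.trans ?_)
      gcongr
      exact (hbdd f).trans (by gcongr)
    · refine normalised_coeff_mul (ha j) ?_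
      rw [hwb]
      refine div_ne_zero (Complex.ofReal_ne_zero.2 ?_) hc
      have := hκ j
      positivity
  · refine (norm_normalised_coeff_le (B := 12 * 4 ^ j) (ha j) (dyadicCoeff_pos n P j).le _ _
      ?_).trans_eq ?_
    · have h4 : (1 : ℝ) ≤ ‖(4 + Complex.I : ℂ)‖ :=
        le_trans (by simp) (Complex.re_le_norm _)
      have h5 : (1 / (16 * 4 ^ j) : ℝ) ≤ 1 := by
        rw [div_le_one (by positivity)]
        linarith [one_le_pow₀ (n := j) (by norm_num : (1 : ℝ) ≤ 4)]
      have h6 : ‖w j * b j‖ ≤ 3 := by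
        rw [hwb, norm_div, Complex.norm_real, Real.norm_eq_abs, abs_of_pos (by positivity)]
        refine (div_le_self (by positivity) h4).trans (by linarith)
      have h7 : (1 : ℝ) ≤ π ^ 2 := one_le_pow₀ (by linarith [Real.pi_gt_three])
      calc 4 * 4 ^ j * ‖w j * b j‖ ≤ 4 * 4 ^ j * 3 := by gcongr
        _ = 1 * (12 * 4 ^ j) := by ring
        _ ≤ _ := by gcongr
    · rw [Real.mul_rpow (by norm_num) (by positivity)]
      ring

/-- Failure of the estimate when the outer exponent is larger than the inner one. -/
lemma not_bounded_of_inner_lt_outer {n : ℕ} (hn : 1 ≤ n) {P s : ℝ} (hP : 1 ≤ P) {Q C : ℝ≥0∞}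
    (hPQ : ENNReal.ofReal P < Q) (hi : Q⁻¹.toReal ≤ P⁻¹) (hs : s ≤ n * (P⁻¹ - Q⁻¹.toReal))
    (hC : C ≠ ∞) (hbdd : ∀ f : SchwartzMap (EuclideanSpace ℝ (Fin n)) ℂ,
      WNorm 0 Q (ENNReal.ofReal P) (schrod 1 ⇑f) ≤ C * WNorm s Q (ENNReal.ofReal P) ⇑f) :
    False := by
  obtain ⟨M, hM, hup⟩ := exists_WNorm_le_of_gt hn hP (K := 1) zero_le_one hPQ hi hs
  obtain ⟨K, hK, hlow⟩ := exists_lpN_dyadicSum_le_space n hP hPQ.le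
  obtain ⟨J, hJ⟩ := exists_lt_lpN_dyadicSum n hP (c := 1) (by norm_num)
    (ENNReal.mul_ne_top hK (ENNReal.mul_ne_top hC hM))
  have ha : ∀ j : ℕ, (0 : ℝ) < 1 / 16 / 4 ^ j := fun j => by positivity
  have hA : ∀ j : ℕ, (0 : ℝ) < 4 ^ j := fun j => by positivity
  set w : ℕ → ℂ := fun j => 1 + (((4 ^ j : ℝ) : ℂ) - Complex.I / 4) with hw
  set b : ℕ → ℂ := fun j => 1 + (3 + 4 * Complex.I) / 5 - 1 / w j with hb
  have hc : ((8 + 4 * Complex.I) / 5 : ℂ) ≠ 0 := fun h => by simpa using congrArg Complex.im h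
  have hwb : ∀ j, w j * b j = (8 + 4 * Complex.I) / 5 * ((4 ^ j + 1 / 2 : ℝ) : ℂ) := fun j => by
    rw [hb, hw]
    simp only
    rw [space_width_mul (hA j)]
    push_cast
    rfl
  set d : ℕ → ℂ := fun j => (dyadicCoeff n P j : ℂ) /
    (schrodCoeff n (((1 / 16 / 4 ^ j : ℝ) : ℂ) + Complex.I / 4) *
      pairCoeff n (w j) (b j)) with hd
  obtain ⟨f, hf, hsf⟩ := exists_schwartz_STFT_eq (n := n) ha d J
  have hinv : ∀ j : ℕ, (1 / (16 * (1 / 16 / 4 ^ j)) : ℝ) = 4 ^ j := fun j => by field_simp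
  simp_rw [hinv] at hsf
  have h1 := hup J d f (fun j => ?_) hf
  · have h2 := hlow J
      (fun j => d j * schrodCoeff n (((1 / 16 / 4 ^ j : ℝ) : ℂ) + Complex.I / 4))
      (schrod 1 f) (fun j => ?_) hsf
    · refine hJ.not_ge (h2.trans ?_)
      gcongr
      exact (hbdd f).trans (by gcongr)
    · refine normalised_coeff_mul (ha j) ?_
      rw [hwb]
      exact mul_ne_zero hc (Complex.ofReal_ne_zero.2 (by positivity))
  · refine (norm_normalised_coeff_le (B := 1) (ha j) (dyadicCoeff_pos n P j).le _ _ ?_).trans_eq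
      (by rw [Real.one_rpow])
    have h4 : ‖((8 + 4 * Complex.I) / 5 : ℂ)‖ ≤ 12 / 5 := by
      rw [norm_div]
      refine (div_le_div_of_nonneg_right (norm_add_le _ _) (norm_nonneg _)).trans_eq ?_
      simp
      norm_num
    have h5 : (1 : ℝ) ≤ 4 ^ j := one_le_pow₀ (by norm_num)
    have h6 : ‖w j * b j‖ ≤ 12 / 5 * (2 * 4 ^ j) := by
      rw [hwb, norm_mul, Complex.norm_real, Real.norm_eq_abs, abs_of_pos (by positivity)]
      gcongr
      linarith
    calc 4 * (1 / 16 / 4 ^ j) * ‖w j * b j‖ ≤ 4 * (1 / 16 / 4 ^ j) * (12 / 5 * (2 * 4 ^ j)) := by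
          gcongr
      _ = 6 / 5 := by field_simp; norm_num
      _ ≤ _ := by nlinarith [Real.pi_gt_three]

lemma exists_eq_ofReal_of_lt {p q : ℝ≥0∞} (hp : 1 ≤ p) (hpq : p < q) :
    ∃ P : ℝ, 1 ≤ P ∧ p = ENNReal.ofReal P ∧ p⁻¹.toReal = P⁻¹ ∧ q⁻¹.toReal ≤ P⁻¹ := by
  have hpt : p ≠ ∞ := hpq.ne_top
  have hp0 : p ≠ 0 := (zero_lt_one.trans_le hp).ne'
  refine ⟨p.toReal, ?_, (ENNReal.ofReal_toReal hpt).symm, ENNReal.toReal_inv p, ?_⟩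
  · rw [← ENNReal.toReal_one]
    exact (ENNReal.toReal_le_toReal ENNReal.one_ne_top hpt).2 hp
  · rw [← ENNReal.toReal_inv]
    exact ENNReal.toReal_mono (ENNReal.inv_ne_top.2 hp0) (ENNReal.inv_le_inv.2 hpq.le)

/-- For `n ≥ 1`, `s ∈ ℝ`, `1 ≤ p, q ≤ ∞` with `p ≠ q`: if `e^{iΔ}` is bounded from
`W^s_{p,q}` to `W_{p,q}`, then `s > n |1/p - 1/q|` (with `1/∞ = 0`). -/
theorem schrodinger_wiener_bounded_only_if (n : ℕ) (hn : 1 ≤ n) (s : ℝ) (p q : ℝ≥0∞)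
    (hp : 1 ≤ p) (hq : 1 ≤ q) (hpq : p ≠ q)
    (hbdd : ∃ C : ℝ, 0 < C ∧ ∀ f : SchwartzMap (EuclideanSpace ℝ (Fin n)) ℂ,
      WNorm 0 p q (schrod 1 ⇑f) ≤ ENNReal.ofReal C * WNorm s p q ⇑f) :
    (n : ℝ) * |p⁻¹.toReal - q⁻¹.toReal| < s := by
  obtain ⟨C, -, hC⟩ := hbdd
  by_contra! hs
  rcases hpq.lt_or_gt with h | h
  · obtain ⟨P, hP, rfl, hinv, hle⟩ := exists_eq_ofReal_of_lt hp h
    rw [hinv, abs_of_nonneg (sub_nonneg.2 hle)] at hs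
    exact not_bounded_of_outer_lt_inner hn hP h hs ENNReal.ofReal_ne_top hC
  · obtain ⟨P, hP, rfl, hinv, hle⟩ := exists_eq_ofReal_of_lt hq h
    rw [hinv, abs_sub_comm, abs_of_nonneg (sub_nonneg.2 hle)] at hs
    exact not_bounded_of_inner_lt_outer hn hP h hle hs ENNReal.ofReal_ne_top hC

end
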